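/- Let $n$ be a positive integer, let $\mathbf m=(m_1,\dots,m_n)\in\mathbb N^n$ (with $0\in\mathbb N$), let $m:=\max_i m_i$, and let $$\mathcal A_{\mathbf m}:=\big\{\{x\in\mathbb R^n: x_i-x_j=s\} : 1\le i<j\le n,\ s\in\mathbb Z,\ -m_i\le s\le m_j\big\}.$$ *Definitions.* Let $\mathcal A_m^n$ be the set of hyperplanes $\{x_i-x_j=s\}$ of $\mathbb R^n$ with $1\le i<j\le n$, $s\in\mathbb Z$, $|s|\le m$. A set $\mathcal A\subseteq\mathcal A_m^n$ is *strongly transitive* if for all distinct $i,j,k\in[n]$ and all $s,t\in\mathbb N$: if $\{x_i-x_j=s\}\notin\mathcal A$ and $\{x_j-x_k=t\}\notin\mathcal A$, then $\{x_i-x_k=s+t\}\notin\mathcal A$. A *face* of $\mathcal A$ is a nonempty set $\bigcap_{H\in\mathcal A}\sigma_H$, where each $\sigma_H$ is $H$ or one of the two open half-spaces bounded by $H$. An *$(m,n)$-tree* $T$ is a rooted plane tree in which every internal vertex (*node*) $j$ has exactly $m+1$ children $0\text{-child}(j),\dots,m\text{-child}(j)$, each of which is a node or a leaf, with $n$ nodes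 labeled bijectively by $[n]$. For a vertex $v$ let $\mathrm{path}(v)=(s_1,\dots,s_k)$ be the sequence of child indices from the root to $v$, and $\mathrm{drift}(v):=s_1+\dots+s_k$. For *distinct* vertices $v,w$ with paths $(s_1,\dots,s_k)$ and $(t_1,\dots,t_\ell)$, write $v\prec_T w$ if $\mathrm{drift}(v)<\mathrm{drift}(w)$, or if $\mathrm{drift}(v)=\mathrm{drift}(w)$ and there is $p\le k$ with $(s_1,\dots,s_p)=(t_1,\dots,t_p)$ and ($p=k$ or $s_{p+1}>t_{p+1}$); write $v\succeq_T w$ if $v=w$ or $w\prec_T v$. A node $i$ is the *$s$-cadet* of $j$ if $i=s\text{-child}(j)$ and $t\text{-child}(j)$ is a leaf for all $s<t\le m$; then $\{i,j\}$ is a *cadet edge*. A *marked $(m,n)$-tree* is a pair $(T,\mu)$ where $T$ is an $(m,n)$-tree and $\mu$ is a set of cadet edges such that $j<i$ for every $\{i,j\}\in\mu$ with $i=0\text{-cadet}(j)$. Write $i\sim_\mu j$ if $i=j$ or all edges on the path of $T$ between $i$ and $j$ are in $\mu$; the equivalence classes of $\sim_\mu$ are the *blocks*. The *$\mathbf m$-reach*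 of a node $j$ of $(T,\mu)$ is $$r_{\mathbf m}(j):=\max\big(m_k+\mathrm{drift}(k)-\mathrm{drift}(j) : k\sim_\mu j,\ k\text{ an ancestor of } j\big),$$ where $j$ counts as an ancestor of itself. For $\mathcal A\subseteq\mathcal A_m^n$, let $\overline{\mathcal T}{}_m^n(\mathcal A)$ be the set of marked $(m,n)$-trees $(T,\mu)$ such that (a) for every block $B$, the graph on $B$ with an edge $\{i,j\}$ whenever $\{x_i-x_j=\mathrm{drift}(i)-\mathrm{drift}(j)\}\in\mathcal A$ is connected, and (b) for every cadet edge $\{i,j\}\notin\mu$ with $i=s\text{-cadet}(j)$, either $s=0$ and $i<j$, or there are $i'\sim_\mu i$ and $j'\sim_\mu j$ with $\{x_{i'}-x_{j'}=\mathrm{drift}(i')-\mathrm{drift}(j')\}\in\mathcal A$. For a marked $(m,n)$-tree $(T,\mu)$, let $\overline\Phi_{\mathcal A}(T,\mu)$ be the set of $x\in\mathbb R^n$ such that $x_i-x_j=s$ for every $\{i,j\}\in\mu$ with $i=s\text{-child}(j)$, and such that for all $i\ne j$ in $[n]$ and $0\le s\le m$ with ($s>0$ or $i>j$), $\{x_i-x_j=s\}\in\mathcal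 A$ and $i\not\sim_\mu j$, one has $x_i-x_j<s$ if $i\prec_T s\text{-child}(j)$, and $x_i-x_j>s$ if $i\succeq_T s\text{-child}(j)$. *Statement.* The arrangement $\mathcal A_{\mathbf m}\subseteq\mathcal A_m^n$ is strongly transitive, and $\overline{\mathcal T}{}_m^n(\mathcal A_{\mathbf m})$ is equal to the set of marked $(m,n)$-trees $(T,\mu)$ such that for every node $j\in[n]$ and every integer $s$ with $r_{\mathbf m}(j)<s\le m$, the vertex $s\text{-child}(j)$ is a leaf. Consequently, $\overline\Phi_{\mathcal A_{\mathbf m}}$ is a bijection from this set of marked trees to the set of faces of $\mathcal A_{\mathbf m}$. -/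

import Mathlib

namespace Braid

/-- The hyperplane `{x ∈ ℝ^n | x i - x j = s}` (for `i ≠ j`). -/
def hyp (n : ℕ) (i j : Fin n) (s : ℝ) : Set (Fin n → ℝ) := {x | x i - x j = s}

/-- The `m`-Catalan arrangement `A_m^n`, as a set of hyperplanes. -/
def catArr (m n : ℕ) : Set (Set (Fin n → ℝ)) :=
  {H | ∃ i j : Fin n, ∃ s : ℤ, i < j ∧ -(m : ℤ) ≤ s ∧ s ≤ (m : ℤ) ∧ H = hyp n i j (s : ℝ)}

/-- The `𝐦`-Catalan arrangement `A_𝐦 = ⋃_{i<j, -m_i ≤ s ≤ m_j} {x_i - x_j = s}`. -/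
def multiCat (n : ℕ) (mv : Fin n → ℕ) : Set (Set (Fin n → ℝ)) :=
  {H | ∃ i j : Fin n, ∃ s : ℤ, i < j ∧ -(mv i : ℤ) ≤ s ∧ s ≤ (mv j : ℤ) ∧
    H = hyp n i j (s : ℝ)}

/-- `(i,j,s) ∈ Tr_m^n`. -/
def TrIdx (m n : ℕ) (i j : Fin n) (s : ℕ) : Prop := s ≤ m ∧ i ≠ j ∧ (0 < s ∨ j < i)

/-- `(i,j,s) ∈ Tr_m^n(A)`. -/
def TrIdxA (m n : ℕ) (A : Set (Set (Fin n → ℝ))) (i j : Fin n) (s : ℕ) : Prop :=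
  TrIdx m n i j s ∧ hyp n i j (s : ℝ) ∈ A

/-- `A` is a strongly transitive subarrangement of `A_m^n`. -/
def IsStronglyTransitive (m n : ℕ) (A : Set (Set (Fin n → ℝ))) : Prop :=
  A ⊆ catArr m n ∧
  ∀ i j k : Fin n, i ≠ j → j ≠ k → i ≠ k → ∀ s t : ℕ,
    hyp n i j (s : ℝ) ∉ A → hyp n j k (t : ℝ) ∉ A → hyp n i k ((s : ℝ) + (t : ℝ)) ∉ A

/-- An `(m,n)`-tree: a rooted `(m+1)`-ary tree with `n` internal nodes labeled bijectively
by `Fin n` (leaves unlabeled), encoded by the root-to-node lists of child indices. The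
vertices are the nodes and their children; `s`-child`(j)` has path `path j ++ [s]`
for `s ≤ m`, and it is a leaf when no node has that path. -/
structure LTree (m n : ℕ) where
  path : Fin n → List ℕ
  entry_le : ∀ v : Fin n, ∀ s ∈ path v, s ≤ m
  inj : Function.Injective path
  parent_closed : ∀ v : Fin n, path v ≠ [] → ∃ w : Fin n, path w = (path v).dropLast

namespace LTree

variable {m n : ℕ}

/-- The drift of a node. -/
def drift (T : LTree m n) (v : Fin n) : ℕ := (T.path v).sum

/-- The node `i` is `s`-child`(j)`. -/
def IsChild (T : LTree m n) (i j : Fin n) (s : ℕ) : Prop := T.path i = T.path j ++ [s]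

/-- The `s`-child of node `j` is a node (not a leaf). -/
def SlotNode (T : LTree m n) (j : Fin n) (s : ℕ) : Prop := ∃ i, T.IsChild i j s

/-- `i = s`-cadet`(j)`. -/
def IsCadet (T : LTree m n) (i j : Fin n) (s : ℕ) : Prop :=
  T.IsChild i j s ∧ ∀ t : ℕ, s < t → t ≤ m → ¬ T.SlotNode j t

end LTree

/-- The strict order `≺_T` on vertices of a tree, expressed on root-to-vertex paths:
`v ≺_T w` iff `v ≠ w` and either `drift(v) < drift(w)`, or the drifts are equal and there is
`c ≤ k` (`k` the length of the path of `v`) with the first `c` entries of both paths equal and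
(`c = k` or the entry of the path of `v` at position `c+1` is larger than that of `w`). -/
def vlt (p q : List ℕ) : Prop :=
  p ≠ q ∧ (p.sum < q.sum ∨
    (p.sum = q.sum ∧ ∃ c ≤ p.length, p.take c = q.take c ∧
      (c = p.length ∨ ∃ (h1 : c < p.length) (h2 : c < q.length), q[c] < p[c])))

/-- `p ≽_T q`. -/
def vge (p q : List ℕ) : Prop := vlt q p ∨ p = q

/-- A valid marking. Since every edge joins a node to its parent, the set of marked edges is
represented by the set `μ` of their lower endpoints. Each marked edge is a cadet edge, and
marked edges `{j, 0-cadet(j)}` satisfy `j < 0-cadet(j)`. -/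
def IsMarking {m n : ℕ} (T : LTree m n) (μ : Set (Fin n)) : Prop :=
  ∀ i ∈ μ, ∃ j s, T.IsCadet i j s ∧ (s = 0 → j < i)

/-- The relation `i ∼_μ j`: `i` and `j` are joined in `T` by marked edges only. -/
def simMu {m n : ℕ} (T : LTree m n) (μ : Set (Fin n)) : Fin n → Fin n → Prop :=
  Relation.ReflTransGen (fun a b =>
    (a ∈ μ ∧ ∃ s, T.IsChild a b s) ∨ (b ∈ μ ∧ ∃ s, T.IsChild b a s))

/-- The block containing node `i`. -/
def blockOf {m n : ℕ} (T : LTree m n) (μ : Set (Fin n)) (i : Fin n) : Set (Fin n) :=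
  {j | simMu T μ i j}

/-- The block `B` is `A`-connected. -/
def BlockConnected {m n : ℕ} (A : Set (Set (Fin n → ℝ))) (T : LTree m n)
    (B : Set (Fin n)) : Prop :=
  ∀ i ∈ B, ∀ j ∈ B, Relation.ReflTransGen
    (fun a b => a ∈ B ∧ b ∈ B ∧ hyp n a b ((T.drift a : ℝ) - (T.drift b : ℝ)) ∈ A) i j

/-- The marked tree `(T,μ)` is `A`-connected. -/
def AConnected {m n : ℕ} (A : Set (Set (Fin n → ℝ))) (T : LTree m n)
    (μ : Set (Fin n)) : Prop :=
  ∀ i : Fin n, BlockConnected A T (blockOf T μ i)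

/-- The `A`-cadet condition. -/
def CadetCond {m n : ℕ} (A : Set (Set (Fin n → ℝ))) (T : LTree m n)
    (μ : Set (Fin n)) : Prop :=
  ∀ i j s, T.IsCadet i j s → i ∉ μ →
    ((s = 0 ∧ i < j) ∨
      ∃ i' j', simMu T μ i' i ∧ simMu T μ j' j ∧
        hyp n i' j' ((T.drift i' : ℝ) - (T.drift j' : ℝ)) ∈ A)

/-- The set `ŌT_m^n` of all marked `(m,n)`-trees. -/
def OTall (m n : ℕ) : Set (LTree m n × Set (Fin n)) := {p | IsMarking p.1 p.2}

/-- The set `ŌT_m^n(A)`. -/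
def OTset (m n : ℕ) (A : Set (Set (Fin n → ℝ))) : Set (LTree m n × Set (Fin n)) :=
  {p ∈ OTall m n | AConnected A p.1 p.2 ∧ CadetCond A p.1 p.2}

/-- The polyhedron `Φ̄_A(T,μ)`. -/
def PhiBar (m n : ℕ) (A : Set (Set (Fin n → ℝ))) (T : LTree m n) (μ : Set (Fin n)) :
    Set (Fin n → ℝ) :=
  {x | (∀ i ∈ μ, ∀ j s, T.IsChild i j s → x i - x j = (s : ℝ)) ∧
       ∀ i j : Fin n, ∀ s : ℕ, TrIdxA m n A i j s → ¬ simMu T μ i j →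
         (vlt (T.path i) (T.path j ++ [s]) → x i - x j < (s : ℝ)) ∧
         (vge (T.path i) (T.path j ++ [s]) → (s : ℝ) < x i - x j)}

/-- `σ` is the hyperplane `H` itself or one of the two open half-spaces bounded by `H`. -/
def IsSideOf (n : ℕ) (σ H : Set (Fin n → ℝ)) : Prop :=
  σ = H ∨ ∃ (i j : Fin n) (s : ℝ), i ≠ j ∧ H = hyp n i j s ∧
    (σ = {x | x i - x j < s} ∨ σ = {x | s < x i - x j})

/-- `F` is a face of the arrangement `A`. -/
def IsFace (n : ℕ) (A : Set (Set (Fin n → ℝ))) (F : Set (Fin n → ℝ)) : Prop :=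
  F.Nonempty ∧ ∃ σ : Set (Fin n → ℝ) → Set (Fin n → ℝ),
    (∀ H ∈ A, IsSideOf n (σ H) H) ∧ F = ⋂ H ∈ A, σ H

/-- The values `m_k + drift(k) - drift(j)` for `k ∼_μ j` and `k` an ancestor of `j`
(`j` being an ancestor of itself). -/
def reachSet {m n : ℕ} (mv : Fin n → ℕ) (T : LTree m n) (μ : Set (Fin n)) (j : Fin n) : Set ℤ :=
  {z : ℤ | ∃ k : Fin n, simMu T μ k j ∧ T.path k <+: T.path j ∧
    z = (mv k : ℤ) + (T.drift k : ℤ) - (T.drift j : ℤ)}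

/-- The `𝐦`-reach of a node `j` of a marked tree: the maximum of `reachSet`. -/
noncomputable def reach {m n : ℕ} (mv : Fin n → ℕ) (T : LTree m n) (μ : Set (Fin n))
    (j : Fin n) : ℤ :=
  sSup (reachSet mv T μ j)

/-- The maximum in the definition of the reach is attained. -/
theorem reach_isGreatest {m n : ℕ} (mv : Fin n → ℕ) (T : LTree m n) (μ : Set (Fin n))
    (j : Fin n) : IsGreatest (reachSet mv T μ j) (reach mv T μ j) := by
  have hne : (reachSet mv T μ j).Nonempty :=
    ⟨_, j, Relation.ReflTransGen.refl, List.prefix_rfl, rfl⟩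
  have hfin : (reachSet mv T μ j).Finite := by
    refine (Set.finite_range fun k : Fin n =>
      (mv k : ℤ) + (T.drift k : ℤ) - (T.drift j : ℤ)).subset ?_
    rintro z ⟨k, -, -, rfl⟩
    exact ⟨k, rfl⟩
  exact ⟨Int.csSup_mem hne hfin.bddAbove, fun z hz => le_csSup hfin.bddAbove hz⟩

/-- The set of marked `(m,n)`-trees such that for every node `j` and every `s > r_𝐦(j)`
(with `s ≤ m`) the vertex `s`-child`(j)` is a leaf. -/
def reachTrees (m n : ℕ) (mv : Fin n → ℕ) : Set (LTree m n × Set (Fin n)) :=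
  {p ∈ OTall m n | ∀ j : Fin n, ∀ s : ℕ, s ≤ m →
    reach mv p.1 p.2 j < (s : ℤ) → ¬ p.1.SlotNode j s}

end Braid

namespace Braid

section ListOrder

/-- Child-index lists, ordered lexicographically with larger entries first. -/
def enc (p : List ℕ) : List ℕᵒᵈ := p.map OrderDual.toDual

/-- At the first position where `p` and `q` differ, the entry of `p` is larger. -/
def Div (p q : List ℕ) : Prop :=
  ∃ c a b r r', p = c ++ a :: r ∧ q = c ++ b :: r' ∧ b < a

theorem enc_injective : Function.Injective enc :=
  List.map_injective_iff.mpr OrderDual.toDual.injective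

theorem enc_cons_lt_cons {a b : ℕ} {p q : List ℕ} :
    enc (a :: p) < enc (b :: q) ↔ b < a ∨ a = b ∧ enc p < enc q := by
  simp only [enc, List.map_cons, List.cons_lt_cons_iff, OrderDual.toDual_lt_toDual,
    EmbeddingLike.apply_eq_iff_eq]

theorem enc_append_lt_append {c p q : List ℕ} : enc (c ++ p) < enc (c ++ q) ↔ enc p < enc q := by
  induction c with
  | nil => simp
  | cons a c ih => simp [enc_cons_lt_cons, ih]

theorem enc_nil_lt_cons (b : ℕ) (q : List ℕ) : enc [] < enc (b :: q) := by
  simp [enc]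

theorem not_enc_lt_nil (p : List ℕ) : ¬ enc p < enc [] := by
  simp [enc]

theorem Div.enc_lt {p q : List ℕ} (h : Div p q) : enc p < enc q := by
  obtain ⟨c, a, b, r, r', rfl, rfl, h⟩ := h
  rw [enc_append_lt_append, enc_cons_lt_cons]
  exact Or.inl h

theorem enc_le_of_isPrefix {p q : List ℕ} (h : p <+: q) : enc p ≤ enc q := by
  obtain ⟨r, rfl⟩ := h
  cases r with
  | nil => simp
  | cons b r =>
    have := enc_append_lt_append (c := p).mpr (enc_nil_lt_cons b r)
    rw [List.append_nil] at this
    exact this.le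

theorem enc_lt_of_isPrefix {p q : List ℕ} (h : p <+: q) (hne : p ≠ q) : enc p < enc q :=
  lt_of_le_of_ne (enc_le_of_isPrefix h) fun e => hne (enc_injective e)

theorem Div.append {p q : List ℕ} (h : Div p q) (r r' : List ℕ) : Div (p ++ r) (q ++ r') := by
  obtain ⟨c, a, b, s, s', rfl, rfl, h⟩ := h
  exact ⟨c, a, b, s ++ r, s' ++ r', by simp, by simp, h⟩

theorem Div.of_isPrefix {p q p' q' : List ℕ} (h : Div p q) (hp : p <+: p') (hq : q <+: q') :
    Div p' q' := by
  obtain ⟨r, rfl⟩ := hp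
  obtain ⟨r', rfl⟩ := hq
  exact h.append r r'

theorem prefix_or_div (p q : List ℕ) : p <+: q ∨ q <+: p ∨ Div p q ∨ Div q p := by
  induction p generalizing q with
  | nil => exact Or.inl ⟨_, rfl⟩
  | cons a p ih =>
    cases q with
    | nil => exact Or.inr (Or.inl ⟨_, rfl⟩)
    | cons b q =>
      rcases lt_trichotomy a b with h | rfl | h
      · exact Or.inr (Or.inr (Or.inr ⟨[], b, a, q, p, rfl, rfl, h⟩))
      · rcases ih q with h | h | ⟨c, u, v, r, r', rfl, rfl, h⟩ | ⟨c, u, v, r, r', rfl, rfl, h⟩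
        · exact Or.inl (List.cons_prefix_cons.mpr ⟨rfl, h⟩)
        · exact Or.inr (Or.inl (List.cons_prefix_cons.mpr ⟨rfl, h⟩))
        · exact Or.inr (Or.inr (Or.inl ⟨a :: c, u, v, r, r', rfl, rfl, h⟩))
        · exact Or.inr (Or.inr (Or.inr ⟨a :: c, u, v, r, r', rfl, rfl, h⟩))
      · exact Or.inr (Or.inr (Or.inl ⟨[], a, b, p, q, rfl, rfl, h⟩))

theorem prefix_or_div_of_enc_le {p q : List ℕ} (h : enc p ≤ enc q) : p <+: q ∨ Div p q := by
  rcases prefix_or_div p q with h1 | h1 | h1 | h1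
  · exact Or.inl h1
  · have := le_antisymm h (enc_le_of_isPrefix h1)
    exact Or.inl (enc_injective this ▸ List.prefix_rfl)
  · exact Or.inr h1
  · exact absurd h1.enc_lt h.not_gt

/-- Among the lists extending `p`, only those continuing with an entry larger than `s`
lie strictly between `p` and `p ++ [s]`. -/
theorem sum_lt_of_enc_lt_append_singleton {p r : List ℕ} {s : ℕ} (hr : r ≠ [])
    (h : enc (p ++ r) < enc (p ++ [s])) : p.sum + s < (p ++ r).sum := by
  rw [enc_append_lt_append] at h
  cases r with
  | nil => exact absurd rfl hr
  | cons u r =>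
    rw [enc_cons_lt_cons] at h
    rcases h with h | ⟨-, h⟩
    · simp only [List.sum_append, List.sum_cons]; omega
    · exact absurd h (not_enc_lt_nil _)

theorem vlt_iff {p q : List ℕ} :
    vlt p q ↔ p.sum < q.sum ∨ (p.sum = q.sum ∧ enc p < enc q) := by
  unfold vlt
  constructor
  · rintro ⟨hne, h | ⟨hs, c, hc, ht, h⟩⟩
    · exact Or.inl h
    · refine Or.inr ⟨hs, ?_⟩
      rcases h with rfl | ⟨h1, h2, h⟩
      · rw [List.take_length] at ht
        exact enc_lt_of_isPrefix (ht ▸ ⟨_, List.take_append_drop _ _⟩) hne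
      · refine Div.enc_lt ⟨p.take c, p[c], q[c], p.drop (c + 1), q.drop (c + 1), ?_, ?_, h⟩
        · rw [← List.drop_eq_getElem_cons, List.take_append_drop]
        · rw [ht, ← List.drop_eq_getElem_cons, List.take_append_drop]
  · rintro (h | ⟨hs, h⟩)
    · exact ⟨fun e => by simp [e] at h, Or.inl h⟩
    · refine ⟨fun e => by simp [e] at h, Or.inr ⟨hs, ?_⟩⟩
      rcases prefix_or_div_of_enc_le h.le with ⟨r, rfl⟩ | ⟨c, a, b, r, r', rfl, rfl, hab⟩
      · exact ⟨p.length, le_rfl, by simp, Or.inl rfl⟩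
      · exact ⟨c.length, by simp, by simp, Or.inr ⟨by simp, by simp, by simpa using hab⟩⟩

theorem vge_iff {p q : List ℕ} :
    vge p q ↔ q.sum < p.sum ∨ (q.sum = p.sum ∧ enc q ≤ enc p) := by
  unfold vge
  rw [vlt_iff]
  constructor
  · rintro ((h | ⟨h, h'⟩) | rfl)
    · exact Or.inl h
    · exact Or.inr ⟨h, h'.le⟩
    · exact Or.inr ⟨rfl, le_rfl⟩
  · rintro (h | ⟨h, h'⟩)
    · exact Or.inl (Or.inl h)
    · rcases h'.lt_or_eq with h' | h'
      · exact Or.inl (Or.inr ⟨h, h'⟩)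
      · exact Or.inr (enc_injective h').symm

end ListOrder

theorem reflTransGen_symm {α : Type*} {r : α → α → Prop} (hr : ∀ a b, r a b → r b a) {a b : α}
    (h : Relation.ReflTransGen r a b) : Relation.ReflTransGen r b a := by
  induction h with
  | refl => exact .refl
  | tail _ h ih => exact .head (hr _ _ h) ih

section Chains

variable {m n : ℕ} {T : LTree m n} {μ : Set (Fin n)}

theorem LTree.IsChild.parent_unique {i j j' : Fin n} {s s' : ℕ} (h : T.IsChild i j s)
    (h' : T.IsChild i j' s') : j = j' ∧ s = s' := by
  obtain ⟨h1, h2⟩ := List.append_inj' (h.symm.trans h') rfl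
  exact ⟨T.inj h1, List.cons.inj h2 |>.1⟩

theorem LTree.IsChild.child_unique {i i' j : Fin n} {s : ℕ} (h : T.IsChild i j s)
    (h' : T.IsChild i' j s) : i = i' :=
  T.inj (h.trans h'.symm)

theorem LTree.IsChild.drift_eq {i j : Fin n} {s : ℕ} (h : T.IsChild i j s) :
    T.drift i = T.drift j + s := by
  unfold LTree.drift
  rw [h]; simp

theorem LTree.IsChild.le {i j : Fin n} {s : ℕ} (h : T.IsChild i j s) : s ≤ m :=
  T.entry_le i s (by rw [h]; simp)

theorem LTree.IsChild.isPrefix {i j : Fin n} {s : ℕ} (h : T.IsChild i j s) :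
    T.path j <+: T.path i := ⟨[s], h.symm⟩

theorem LTree.IsChild.ne {i j : Fin n} {s : ℕ} (h : T.IsChild i j s) : i ≠ j := by
  rintro rfl
  have := congrArg List.length h
  simp at this

theorem LTree.exists_parent {i : Fin n} (h : T.path i ≠ []) : ∃ j s, T.IsChild i j s := by
  obtain ⟨w, hw⟩ := T.parent_closed i h
  exact ⟨w, (T.path i).getLast h, by
    unfold LTree.IsChild; rw [hw, List.dropLast_append_getLast]⟩

theorem LTree.exists_of_isPrefix {i : Fin n} {p : List ℕ} (h : p <+: T.path i) :
    ∃ w, T.path w = p := by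
  obtain ⟨r, hr⟩ := h
  induction r using List.reverseRecOn generalizing i with
  | nil => exact ⟨i, by simpa using hr.symm⟩
  | append_singleton r a ih =>
    obtain ⟨w, hw⟩ := T.parent_closed i (by rw [← hr]; simp)
    refine ih (i := w) ?_
    rw [hw, ← hr, ← List.append_assoc, List.dropLast_concat]

theorem LTree.IsCadet.le_of_isChild {i i' j : Fin n} {s t : ℕ} (h : T.IsCadet i j s)
    (h' : T.IsChild i' j t) : t ≤ s := by
  by_contra hlt
  exact h.2 t (not_le.mp hlt) h'.le ⟨i', h'⟩

/-- `b` is joined to its parent `a` by a marked edge. -/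
def MStep (T : LTree m n) (μ : Set (Fin n)) (a b : Fin n) : Prop := b ∈ μ ∧ ∃ s, T.IsChild b a s

/-- `b` is a descendant of `a` along marked edges. -/
abbrev Chain (T : LTree m n) (μ : Set (Fin n)) : Fin n → Fin n → Prop :=
  Relation.ReflTransGen (MStep T μ)

theorem MStep.left_unique {a b c : Fin n} (h : MStep T μ a c) (h' : MStep T μ b c) : a = b := by
  obtain ⟨-, s, hs⟩ := h
  obtain ⟨-, t, ht⟩ := h'
  exact (hs.parent_unique ht).1

theorem IsMarking.cadet (hμ : IsMarking T μ) {i j : Fin n} {s : ℕ} (hi : i ∈ μ)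
    (h : T.IsChild i j s) : T.IsCadet i j s ∧ (s = 0 → j < i) := by
  obtain ⟨j', s', hc, h0⟩ := hμ i hi
  obtain ⟨rfl, rfl⟩ := hc.1.parent_unique h
  exact ⟨hc, h0⟩

theorem MStep.right_unique (hμ : IsMarking T μ) {a b c : Fin n} (h : MStep T μ a b)
    (h' : MStep T μ a c) : b = c := by
  obtain ⟨hb, s, hs⟩ := h
  obtain ⟨hc, t, ht⟩ := h'
  have h1 := (hμ.cadet hb hs).1.le_of_isChild ht
  have h2 := (hμ.cadet hc ht).1.le_of_isChild hs
  obtain rfl := le_antisymm h1 h2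
  exact hs.child_unique ht

theorem Chain.path_isPrefix {a i : Fin n} (h : Chain T μ a i) : T.path a <+: T.path i := by
  induction h with
  | refl => exact List.prefix_rfl
  | tail _ h ih => obtain ⟨-, s, hs⟩ := h; exact ih.trans hs.isPrefix

theorem LTree.drift_le_of_isPrefix {a i : Fin n} (h : T.path a <+: T.path i) :
    T.drift a ≤ T.drift i := by
  obtain ⟨r, hr⟩ := h
  unfold LTree.drift
  rw [← hr]; simp

theorem Chain.drift_le {a i : Fin n} (h : Chain T μ a i) : T.drift a ≤ T.drift i :=
  T.drift_le_of_isPrefix h.path_isPrefix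

theorem Chain.lt_or_le (hμ : IsMarking T μ) {a i : Fin n} (h : Chain T μ a i) :
    T.drift a < T.drift i ∨ (T.drift a = T.drift i ∧ a ≤ i) := by
  induction h with
  | refl => exact Or.inr ⟨rfl, le_rfl⟩
  | @tail b c _ h ih =>
    obtain ⟨hc, s, hs⟩ := h
    have := hs.drift_eq
    have h0 := (hμ.cadet hc hs).2
    rcases Nat.eq_zero_or_pos s with rfl | hs0
    · have := h0 rfl
      rcases ih with ih | ⟨ih, ih'⟩
      · left; omega
      · exact Or.inr ⟨by omega, ih'.trans this.le⟩
    · left; rcases ih with ih | ⟨ih, -⟩ <;> omega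

theorem Chain.eq_of_notMem {a b : Fin n} (h : Chain T μ a b) (hb : b ∉ μ) : a = b := by
  rcases Relation.ReflTransGen.cases_tail h with h | ⟨c, -, h⟩
  · exact h.symm
  · exact absurd h.1 hb

theorem Chain.antisymm {a b : Fin n} (h : Chain T μ a b) (h' : T.path b <+: T.path a) : a = b :=
  T.inj (h.path_isPrefix.eq_of_length (le_antisymm h.path_isPrefix.length_le h'.length_le))

theorem Chain.total_of_common_end {a b i : Fin n} (ha : Chain T μ a i) (hb : Chain T μ b i) :
    Chain T μ a b ∨ Chain T μ b a := by
  have U : Relator.RightUnique (Function.swap (MStep T μ)) := fun _ _ _ h h' => h.left_unique h'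
  have := Relation.ReflTransGen.total_of_right_unique U
    (Relation.reflTransGen_swap.mpr ha) (Relation.reflTransGen_swap.mpr hb)
  exact this.symm.imp Relation.reflTransGen_swap.mp Relation.reflTransGen_swap.mp

theorem Chain.total_of_common_start (hμ : IsMarking T μ) {a i j : Fin n} (hi : Chain T μ a i)
    (hj : Chain T μ a j) : Chain T μ i j ∨ Chain T μ j i :=
  Relation.ReflTransGen.total_of_right_unique (fun _ _ _ h h' => h.right_unique hμ h') hi hj

theorem exists_top (hμ : IsMarking T μ) (i : Fin n) : ∃ a, Chain T μ a i ∧ a ∉ μ := by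
  induction h : (T.path i).length using Nat.strong_induction_on generalizing i with
  | _ k ih =>
    by_cases hi : i ∈ μ
    · obtain ⟨j, s, hc, -⟩ := hμ i hi
      have hl : (T.path j).length < k := by rw [← h, hc.1]; simp
      obtain ⟨a, ha, ha'⟩ := ih _ hl j rfl
      exact ⟨a, ha.tail ⟨hi, s, hc.1⟩, ha'⟩
    · exact ⟨i, .refl, hi⟩

open Classical in
/-- The topmost node of the block of `i`. -/
noncomputable def top (T : LTree m n) (μ : Set (Fin n)) (i : Fin n) : Fin n :=
  if h : ∃ a, Chain T μ a i ∧ a ∉ μ then h.choose else i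

theorem top_spec (hμ : IsMarking T μ) (i : Fin n) : Chain T μ (top T μ i) i ∧ top T μ i ∉ μ := by
  rw [top, dif_pos (exists_top hμ i)]
  exact (exists_top hμ i).choose_spec

theorem top_eq (hμ : IsMarking T μ) {a i : Fin n} (h : Chain T μ a i) (ha : a ∉ μ) :
    top T μ i = a := by
  obtain ⟨h1, h2⟩ := top_spec hμ i
  rcases h.total_of_common_end h1 with h | h
  · exact (h.eq_of_notMem h2).symm
  · exact h.eq_of_notMem ha

theorem top_eq_self (hμ : IsMarking T μ) {i : Fin n} (h : i ∉ μ) : top T μ i = i :=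
  top_eq hμ .refl h

theorem Chain.top_eq (hμ : IsMarking T μ) {i j : Fin n} (h : Chain T μ i j) :
    top T μ j = top T μ i :=
  Braid.top_eq hμ ((top_spec hμ i).1.trans h) (top_spec hμ i).2

theorem chain_or_chain_of_top_eq (hμ : IsMarking T μ) {i j : Fin n} (h : top T μ i = top T μ j) :
    Chain T μ i j ∨ Chain T μ j i :=
  Chain.total_of_common_start hμ (h ▸ (top_spec hμ i).1) (top_spec hμ j).1

theorem Chain.simMu {a b : Fin n} (h : Chain T μ a b) : simMu T μ a b :=
  Relation.ReflTransGen.mono (fun _ _ h => Or.inr h) _ _ h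

theorem simMu_symm {a b : Fin n} (h : simMu T μ a b) : simMu T μ b a :=
  reflTransGen_symm (fun _ _ h => Or.symm h) h

theorem simMu_iff (hμ : IsMarking T μ) {i j : Fin n} : simMu T μ i j ↔ top T μ i = top T μ j := by
  constructor
  · intro h
    induction h with
    | refl => rfl
    | tail _ h ih =>
      rw [ih]
      rcases h with h | h
      · exact Chain.top_eq hμ (.single h)
      · exact (Chain.top_eq hμ (.single h)).symm
  · intro h
    rcases chain_or_chain_of_top_eq hμ h with h | h
    · exact h.simMu
    · exact simMu_symm h.simMu

theorem Chain.between {a i q : Fin n} (h : Chain T μ a i) (haq : T.path a <+: T.path q)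
    (hqi : T.path q <+: T.path i) : Chain T μ a q ∧ Chain T μ q i := by
  induction h with
  | refl =>
    obtain rfl : a = q := T.inj (haq.eq_of_length (le_antisymm haq.length_le hqi.length_le))
    exact ⟨.refl, .refl⟩
  | @tail b c hab hbc ih =>
    obtain ⟨hc, s, hs⟩ := hbc
    rw [hs, List.prefix_concat_iff] at hqi
    rcases hqi with hqi | hqi
    · obtain rfl : q = c := T.inj (hqi.trans hs.symm)
      exact ⟨hab.tail ⟨hc, s, hs⟩, .refl⟩
    · exact ⟨(ih hqi).1, (ih hqi).2.tail ⟨hc, s, hs⟩⟩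

/-- Marked chains follow rightmost children: a descendant of the start of a chain is on it,
below its end, or branches off to the left. -/
theorem Chain.prefix_or_div (hμ : IsMarking T μ) {a i q : Fin n} (h : Chain T μ a i)
    (haq : T.path a <+: T.path q) :
    T.path q <+: T.path i ∨ T.path i <+: T.path q ∨ Div (T.path i) (T.path q) := by
  induction h with
  | refl => exact Or.inr (Or.inl haq)
  | @tail b c hab hbc ih =>
    obtain ⟨hc, s, hs⟩ := hbc
    rcases ih with ih | ih | ih
    · exact Or.inl (ih.trans hs.isPrefix)
    · obtain ⟨r, hr⟩ := ih
      cases r with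
      | nil => exact Or.inl (by rw [← hr, List.append_nil]; exact hs.isPrefix)
      | cons t r =>
        obtain ⟨w, hw⟩ := T.exists_of_isPrefix (i := q) (p := T.path b ++ [t])
          ⟨r, by rw [← hr]; simp⟩
        have hle := (hμ.cadet hc hs).1.le_of_isChild (i' := w) hw
        rcases hle.lt_or_eq with h | rfl
        · exact Or.inr (Or.inr ⟨T.path b, s, t, [], r, hs, hr.symm, h⟩)
        · exact Or.inr (Or.inl ⟨r, by rw [hs, ← hr]; simp⟩)
    · exact Or.inr (Or.inr (ih.of_isPrefix hs.isPrefix List.prefix_rfl))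

/-- The position of the block of `i` in the lexicographic order. -/
noncomputable def key (T : LTree m n) (μ : Set (Fin n)) (i : Fin n) : List ℕᵒᵈ :=
  enc (T.path (top T μ i))

theorem key_eq_iff {i j : Fin n} : key T μ i = key T μ j ↔ top T μ i = top T μ j :=
  ⟨fun h => T.inj (enc_injective h), fun h => by rw [key, key, h]⟩

theorem Chain.key_eq (hμ : IsMarking T μ) {i j : Fin n} (h : Chain T μ i j) :
    key T μ j = key T μ i := key_eq_iff.mpr (h.top_eq hμ)

/-- No block whose top has drift at most `drift i` lies strictly between the block of the
parent of `i` and the one headed by `i`. -/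
theorem key_le_of_key_lt (hμ : IsMarking T μ) {i j₀ j : Fin n} {s₀ : ℕ} (hi : i ∉ μ)
    (hc : T.IsChild i j₀ s₀) (hd : T.drift j ≤ T.drift i) (h : key T μ j < key T μ i) :
    key T μ j ≤ key T μ j₀ := by
  unfold key at *
  rw [top_eq_self hμ hi] at h
  obtain ⟨hj, hjμ⟩ := top_spec hμ j
  obtain ⟨ha, haμ⟩ := top_spec hμ j₀
  set t := top T μ j
  set a := top T μ j₀
  by_contra hlt
  rw [not_le] at hlt
  have hdt : T.drift t ≤ T.drift i := hj.drift_le.trans hd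
  rcases prefix_or_div_of_enc_le hlt.le with hp | hp
  · have hcase : ∀ r, T.path t = T.path j₀ ++ r → r ≠ [] → False := by
      intro r hr hr0
      rw [hc, hr] at h
      have := sum_lt_of_enc_lt_append_singleton hr0 h
      rw [← hr] at this
      have h2 := hc.drift_eq
      unfold LTree.drift at *
      omega
    have hin : T.path t <+: T.path j₀ → False := by
      intro hin
      have := ((ha.between hp hin).1).eq_of_notMem hjμ
      rw [this] at hlt
      exact lt_irrefl _ hlt
    rcases ha.prefix_or_div hμ hp with h1 | ⟨r, h1⟩ | h1
    · exact hin h1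
    · by_cases hr : r = []
      · exact hin (by rw [← h1, hr, List.append_nil])
      · exact hcase r h1.symm hr
    · exact lt_asymm h (h1.of_isPrefix hc.isPrefix List.prefix_rfl).enc_lt
  · exact lt_asymm h (hp.of_isPrefix (ha.path_isPrefix.trans hc.isPrefix) List.prefix_rfl).enc_lt

theorem key_lt_of_isChild (hμ : IsMarking T μ) {i j : Fin n} {s : ℕ} (hi : i ∉ μ)
    (hc : T.IsChild i j s) : key T μ j < key T μ i := by
  unfold key
  rw [top_eq_self hμ hi]
  have h := (top_spec hμ j).1
  refine enc_lt_of_isPrefix (h.path_isPrefix.trans hc.isPrefix) fun e => ?_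
  have := congrArg List.length e
  have h1 := h.path_isPrefix.length_le
  rw [hc] at this
  simp at this
  omega

/-- Between distinct blocks, the order on the vertices of the tree is governed by the drift and
by the order on blocks. -/
theorem enc_path_lt_iff_key_lt (hμ : IsMarking T μ) {i j : Fin n} {s : ℕ}
    (hne : top T μ i ≠ top T μ j) (hd : T.drift i = T.drift j + s) :
    enc (T.path i) < enc (T.path j ++ [s]) ↔ key T μ i < key T μ j := by
  unfold key
  obtain ⟨hi, hiμ⟩ := top_spec hμ i
  obtain ⟨hj, hjμ⟩ := top_spec hμ j
  have hji : T.path j <+: T.path j ++ [s] := List.prefix_append _ _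
  rcases prefix_or_div (T.path (top T μ i)) (T.path (top T μ j)) with h | h | h | h
  · refine iff_of_true ?_ (enc_lt_of_isPrefix h fun e => hne (T.inj e))
    rcases hi.prefix_or_div hμ (h.trans hj.path_isPrefix) with h1 | h1 | h1
    · exact absurd (top_eq hμ (hi.between (h.trans hj.path_isPrefix) h1).1 hiμ).symm hne
    · refine enc_lt_of_isPrefix (h1.trans hji) fun e => ?_
      have := congrArg List.length e
      have := h1.length_le
      simp at *
      omega
    · exact (h1.of_isPrefix List.prefix_rfl hji).enc_lt
  · refine iff_of_false ?_ (enc_le_of_isPrefix h).not_gt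
    have hin : T.path i <+: T.path j → False := fun h1 =>
      hne (top_eq hμ (hj.between (h.trans hi.path_isPrefix) h1).1 hjμ)
    rcases hj.prefix_or_div hμ (h.trans hi.path_isPrefix) with h1 | ⟨r, h1⟩ | h1
    · exact (hin h1).elim
    · intro hlt
      by_cases hr : r = []
      · exact hin (by rw [← h1, hr, List.append_nil])
      · rw [← h1] at hlt
        have := sum_lt_of_enc_lt_append_singleton hr hlt
        rw [h1] at this
        unfold LTree.drift at hd
        omega
    · exact (h1.of_isPrefix hji List.prefix_rfl).enc_lt.not_gt
  · exact iff_of_true (h.of_isPrefix hi.path_isPrefix (hj.path_isPrefix.trans hji)).enc_lt h.enc_lt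
  · exact iff_of_false (h.of_isPrefix (hj.path_isPrefix.trans hji) hi.path_isPrefix).enc_lt.not_gt
      h.enc_lt.not_gt

end Chains

section Arrangement

variable {n : ℕ}

theorem hyp_swap (i j : Fin n) (s : ℝ) : hyp n i j s = hyp n j i (-s) := by
  ext x; simp only [hyp, Set.mem_ofPred_eq]; constructor <;> intro h <;> linarith

theorem hyp_eq_hyp {i j a b : Fin n} {s t : ℝ} (hij : i ≠ j) (hab : a ≠ b)
    (h : hyp n i j s = hyp n a b t) : (a = i ∧ b = j ∧ t = s) ∨ (a = j ∧ b = i ∧ t = -s) := by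
  classical
  have key : ∀ x : Fin n → ℝ, x i - x j = s ↔ x a - x b = t := fun x => Set.ext_iff.mp h x
  have h0 := (key (Pi.single i s)).mp (by simp [hij.symm])
  have shift : ∀ k, k ≠ i → k ≠ j → k ≠ a ∧ k ≠ b := by
    intro k hi hj
    have h1 := (key (Pi.single i s + Pi.single k 1)).mp (by
      simp [hij.symm, hi.symm, hj.symm])
    simp only [Pi.add_apply] at h1
    constructor
    · rintro rfl
      have : (Pi.single k (1 : ℝ) : Fin n → ℝ) b = 0 := by simp [hab.symm]
      rw [this, Pi.single_eq_same] at h1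
      linarith
    · rintro rfl
      have : (Pi.single k (1 : ℝ) : Fin n → ℝ) a = 0 := by simp [hab]
      rw [this, Pi.single_eq_same] at h1
      linarith
  have ha : a = i ∨ a = j := by
    by_contra hc; push Not at hc; exact (shift a hc.1 hc.2).1 rfl
  have hb : b = i ∨ b = j := by
    by_contra hc; push Not at hc; exact (shift b hc.1 hc.2).2 rfl
  rcases ha with rfl | rfl <;> rcases hb with rfl | rfl
  · exact absurd rfl hab
  · left; simp [hij.symm] at h0; exact ⟨rfl, rfl, h0.symm⟩
  · right; simp [hij.symm] at h0; exact ⟨rfl, rfl, h0.symm⟩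
  · exact absurd rfl hab

variable {mv : Fin n → ℕ}

theorem hyp_mem_multiCat {i j : Fin n} (hij : i ≠ j) (s : ℕ) :
    hyp n i j (s : ℝ) ∈ multiCat n mv ↔ s ≤ mv j := by
  constructor
  · rintro ⟨a, b, z, hab, h1, h2, h⟩
    rcases hyp_eq_hyp hij hab.ne h with ⟨rfl, rfl, hz⟩ | ⟨rfl, rfl, hz⟩
    · have : z = s := by exact_mod_cast hz
      omega
    · have : z = -(s : ℤ) := by exact_mod_cast hz
      omega
  · intro hs
    rcases lt_or_gt_of_ne hij with h | h
    · exact ⟨i, j, s, h, by omega, by omega, by simp⟩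
    · exact ⟨j, i, -(s : ℤ), h, by omega, by omega, by rw [hyp_swap]; simp⟩

theorem exists_hyp_of_mem_multiCat {H : Set (Fin n → ℝ)} (h : H ∈ multiCat n mv) :
    ∃ i j : Fin n, ∃ s : ℕ, i ≠ j ∧ s ≤ mv j ∧ H = hyp n i j (s : ℝ) := by
  obtain ⟨a, b, z, hab, h1, h2, rfl⟩ := h
  rcases le_total 0 z with hz | hz
  · lift z to ℕ using hz
    exact ⟨a, b, z, hab.ne, by omega, by simp⟩
  · obtain ⟨w, rfl⟩ : ∃ w : ℕ, z = -(w : ℤ) := ⟨z.natAbs, by omega⟩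
    exact ⟨b, a, w, hab.ne', by omega, by rw [hyp_swap]; simp⟩

theorem multiCat_stronglyTransitive (m : ℕ) (hm : m = Finset.univ.sup mv) :
    IsStronglyTransitive m n (multiCat n mv) := by
  have hle : ∀ i, mv i ≤ m := fun i => hm ▸ Finset.le_sup (Finset.mem_univ i)
  refine ⟨?_, ?_⟩
  · rintro H ⟨i, j, s, hij, h1, h2, rfl⟩
    have := hle i
    have := hle j
    exact ⟨i, j, s, hij, by omega, by omega, rfl⟩
  · intro i j k hij hjk hik s t hs ht
    rw [← Nat.cast_add, hyp_mem_multiCat hik]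
    rw [hyp_mem_multiCat hjk] at ht
    omega

/-- The points on the same side of every hyperplane of `multiCat n mv` as `y`. -/
def signClass (mv : Fin n → ℕ) (y : Fin n → ℝ) : Set (Fin n → ℝ) :=
  {x | ∀ i j, i ≠ j → ∀ s : ℕ, s ≤ mv j →
    (x i < x j + s ↔ y i < y j + s) ∧ (x i = x j + s ↔ y i = y j + s)}

theorem isSideOf_hyp {i j : Fin n} (hij : i ≠ j) {s : ℝ} {σ : Set (Fin n → ℝ)} :
    IsSideOf n σ (hyp n i j s) ↔
      σ = {x | x i = x j + s} ∨ σ = {x | x i < x j + s} ∨ σ = {x | x j + s < x i} := by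
  have e0 : hyp n i j s = {x | x i = x j + s} := by
    ext x; simp only [hyp, Set.mem_ofPred_eq]; constructor <;> intro h <;> linarith
  have e1 : {x : Fin n → ℝ | x i < x j + s} = {x | x i - x j < s} := by
    ext x; simp only [Set.mem_ofPred_eq]; constructor <;> intro h <;> linarith
  have e2 : {x : Fin n → ℝ | x j + s < x i} = {x | s < x i - x j} := by
    ext x; simp only [Set.mem_ofPred_eq]; constructor <;> intro h <;> linarith
  rw [e1, e2, ← e0]
  constructor
  · rintro (h | ⟨a, b, t, hab, hH, h⟩)
    · exact Or.inl h
    · right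
      rcases hyp_eq_hyp hij hab hH with ⟨rfl, rfl, rfl⟩ | ⟨rfl, rfl, rfl⟩
      · exact h
      · rcases h with rfl | rfl
        · right; ext x; simp only [Set.mem_ofPred_eq]; constructor <;> intro h <;> linarith
        · left; ext x; simp only [Set.mem_ofPred_eq]; constructor <;> intro h <;> linarith
  · rintro (h | h)
    · exact Or.inl h
    · exact Or.inr ⟨i, j, s, hij, rfl, h⟩

theorem mem_signClass_self (y : Fin n → ℝ) : y ∈ signClass mv y :=
  fun _ _ _ _ _ => ⟨Iff.rfl, Iff.rfl⟩

theorem iInter_sides_eq_signClass {σ : Set (Fin n → ℝ) → Set (Fin n → ℝ)} {y : Fin n → ℝ}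
    (hσ : ∀ H ∈ multiCat n mv, IsSideOf n (σ H) H) (hy : y ∈ ⋂ H ∈ multiCat n mv, σ H) :
    ⋂ H ∈ multiCat n mv, σ H = signClass mv y := by
  rw [Set.mem_iInter₂] at hy
  ext x
  rw [Set.mem_iInter₂]
  constructor
  · intro hx i j hij s hs
    have hH := (hyp_mem_multiCat (mv := mv) hij s).mpr hs
    have hx := hx _ hH
    have hy := hy _ hH
    rcases (isSideOf_hyp hij).mp (hσ _ hH) with h | h | h <;>
      rw [h, Set.mem_ofPred_eq] at hx hy
    · exact ⟨iff_of_false (by linarith) (by linarith), iff_of_true hx hy⟩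
    · exact ⟨iff_of_true hx hy, iff_of_false hx.ne hy.ne⟩
    · exact ⟨iff_of_false hx.not_gt hy.not_gt, iff_of_false hx.ne' hy.ne'⟩
  · intro hx H hH
    have hy := hy _ hH
    obtain ⟨i, j, s, hij, hs, rfl⟩ := exists_hyp_of_mem_multiCat hH
    obtain ⟨h1, h2⟩ := hx i j hij s hs
    rcases (isSideOf_hyp hij).mp (hσ _ hH) with h | h | h <;>
      rw [h, Set.mem_ofPred_eq] at hy ⊢
    · exact h2.mpr hy
    · exact h1.mpr hy
    · exact lt_of_le_of_ne (not_lt.mp fun h => hy.not_gt (h1.mp h)) fun h => hy.ne' (h2.mp h.symm)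

theorem isFace_iff_signClass {F : Set (Fin n → ℝ)} :
    IsFace n (multiCat n mv) F ↔ ∃ y, F = signClass mv y := by
  constructor
  · rintro ⟨⟨y, hy⟩, σ, hσ, rfl⟩
    exact ⟨y, iInter_sides_eq_signClass hσ hy⟩
  · rintro ⟨y, rfl⟩
    have : ∀ H : Set (Fin n → ℝ), ∃ S : Set (Fin n → ℝ),
        H ∈ multiCat n mv → IsSideOf n S H ∧ y ∈ S := by
      intro H
      by_cases hH : H ∈ multiCat n mv
      · obtain ⟨i, j, s, hij, hs, rfl⟩ := exists_hyp_of_mem_multiCat hH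
        rcases lt_trichotomy (y i) (y j + s) with h | h | h
        · exact ⟨{x | x i < x j + s}, fun _ => ⟨(isSideOf_hyp hij).mpr (by simp), h⟩⟩
        · exact ⟨{x | x i = x j + s}, fun _ => ⟨(isSideOf_hyp hij).mpr (by simp), h⟩⟩
        · exact ⟨{x | x j + s < x i}, fun _ => ⟨(isSideOf_hyp hij).mpr (by simp), h⟩⟩
      · exact ⟨∅, fun h => absurd h hH⟩
    choose σ hσ using this
    have hy : y ∈ ⋂ H ∈ multiCat n mv, σ H := Set.mem_iInter₂.mpr fun H hH => (hσ H hH).2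
    exact ⟨⟨y, mem_signClass_self y⟩, σ, fun H hH => (hσ H hH).1,
      (iInter_sides_eq_signClass (fun H hH => (hσ H hH).1) hy).symm⟩

end Arrangement

section Reach

variable {m n : ℕ} {T : LTree m n} {μ : Set (Fin n)} {mv : Fin n → ℕ}

/-- Every child index is bounded by the reach of the parent. -/
def ReachCond (mv : Fin n → ℕ) (T : LTree m n) (μ : Set (Fin n)) : Prop :=
  ∀ i j s, T.IsChild i j s → ∃ k, Chain T μ k j ∧ T.drift j + s ≤ mv k + T.drift k

theorem chain_iff_simMu_and_isPrefix (hμ : IsMarking T μ) {k j : Fin n} :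
    Chain T μ k j ↔ simMu T μ k j ∧ T.path k <+: T.path j := by
  constructor
  · exact fun h => ⟨h.simMu, h.path_isPrefix⟩
  · rintro ⟨h1, h2⟩
    rcases chain_or_chain_of_top_eq hμ ((simMu_iff hμ).mp h1) with h | h
    · exact h
    · rw [h.antisymm h2]

theorem mem_reachTrees_iff :
    (T, μ) ∈ reachTrees m n mv ↔ IsMarking T μ ∧ ReachCond mv T μ := by
  change IsMarking T μ ∧ (∀ j : Fin n, ∀ s : ℕ, s ≤ m →
    reach mv T μ j < (s : ℤ) → ¬ T.SlotNode j s) ↔ _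
  refine and_congr_right fun hμ => ?_
  constructor
  · intro h i j s hc
    obtain ⟨k, hk, hk', hz⟩ := (reach_isGreatest mv T μ j).1
    refine ⟨k, (chain_iff_simMu_and_isPrefix hμ).mpr ⟨hk, hk'⟩, ?_⟩
    have : ¬ reach mv T μ j < s := fun hlt => h j s hc.le hlt ⟨i, hc⟩
    omega
  · rintro h j s - hlt ⟨i, hc⟩
    obtain ⟨k, hk, hks⟩ := h i j s hc
    have := (reach_isGreatest mv T μ j).2 ⟨k, hk.simMu, hk.path_isPrefix, rfl⟩
    omega

theorem hyp_drift_mem {a b : Fin n} (hab : a ≠ b) (hd : T.drift b ≤ T.drift a) :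
    hyp n a b ((T.drift a : ℝ) - (T.drift b : ℝ)) ∈ multiCat n mv ↔
      T.drift a ≤ mv b + T.drift b := by
  rw [← Nat.cast_sub hd, hyp_mem_multiCat hab]
  omega

theorem hyp_drift_swap {a b : Fin n} :
    hyp n a b ((T.drift a : ℝ) - (T.drift b : ℝ)) = hyp n b a ((T.drift b : ℝ) - (T.drift a)) := by
  rw [hyp_swap, neg_sub]

theorem ReachCond.aConnected (hμ : IsMarking T μ) (h : ReachCond mv T μ) :
    AConnected (multiCat n mv) T μ := by
  intro i₀
  set B := blockOf T μ i₀
  set R := fun a b => a ∈ B ∧ b ∈ B ∧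
    hyp n a b ((T.drift a : ℝ) - (T.drift b : ℝ)) ∈ multiCat n mv
  have hB : ∀ a, a ∈ B ↔ top T μ i₀ = top T μ a := fun a => simMu_iff hμ
  have hR : ∀ a b, R a b → R b a := fun a b ⟨h1, h2, h3⟩ => ⟨h2, h1, hyp_drift_swap ▸ h3⟩
  have key : ∀ a ∈ B, Relation.ReflTransGen R a (top T μ i₀) := by
    intro a
    induction hl : (T.path a).length using Nat.strong_induction_on generalizing a with
    | _ l ih =>
      intro ha
      by_cases hm : a ∈ μ
      · obtain ⟨j, s, hc, -⟩ := hμ a hm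
        obtain ⟨k, hk, hks⟩ := h a j s hc.1
        have hka : Chain T μ k a := hk.tail ⟨hm, s, hc.1⟩
        have hlt : (T.path k).length < l := by
          have := hk.path_isPrefix.length_le
          rw [← hl, hc.1]; simp; omega
        have hkB : k ∈ B := (hB k).mpr (((hB a).mp ha).trans (hka.top_eq hμ))
        have hne : a ≠ k := by rintro rfl; omega
        refine .head ⟨ha, hkB, (hyp_drift_mem hne hka.drift_le).mpr ?_⟩ (ih _ hlt k rfl hkB)
        rw [hc.1.drift_eq]; exact hks
      · rw [(hB a).mp ha, top_eq_self hμ hm]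
  intro i hi j hj
  exact (key i hi).trans (reflTransGen_symm hR (key j hj))

theorem ReachCond.cadetCond (h : ReachCond mv T μ) :
    CadetCond (multiCat n mv) T μ := by
  intro i j s hc hi
  obtain ⟨k, hk, hks⟩ := h i j s hc.1
  have hki : T.path k <+: T.path i := hk.path_isPrefix.trans hc.1.isPrefix
  have hne : i ≠ k := by
    rintro rfl
    have := hk.path_isPrefix.length_le
    rw [hc.1] at this
    simp at this
  refine Or.inr ⟨i, k, .refl, hk.simMu, (hyp_drift_mem hne (T.drift_le_of_isPrefix hki)).mpr ?_⟩
  rw [hc.1.drift_eq]; exact hks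

theorem LTree.exists_cadet {i j : Fin n} {s : ℕ} (h : T.IsChild i j s) :
    ∃ i' s', T.IsCadet i' j s' ∧ s ≤ s' := by
  classical
  have h1 := Nat.findGreatest_spec (P := fun t => T.SlotNode j t) h.le ⟨i, h⟩
  obtain ⟨i', hi'⟩ := h1
  exact ⟨i', _, ⟨hi', fun t ht htm hs => Nat.findGreatest_is_greatest ht htm hs⟩,
    Nat.le_findGreatest h.le ⟨i, h⟩⟩

theorem reachCond_of_aConnected (hμ : IsMarking T μ) (hA : AConnected (multiCat n mv) T μ)
    (hC : CadetCond (multiCat n mv) T μ) : ReachCond mv T μ := by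
  intro i₀ j s₀ hc₀
  obtain ⟨i, s, hc, hs⟩ := T.exists_cadet hc₀
  suffices ∃ k, Chain T μ k j ∧ T.drift j + s ≤ mv k + T.drift k by
    obtain ⟨k, hk, h⟩ := this
    exact ⟨k, hk, by omega⟩
  have hd := hc.1.drift_eq
  by_cases hi : i ∈ μ
  · have hstep : MStep T μ j i := ⟨hi, s, hc.1⟩
    have hji : Chain T μ j i := .single hstep
    have hcon := hA j j (by exact Relation.ReflTransGen.refl) i hji.simMu
    have cross : ∃ a b, Chain T μ a j ∧ ¬ Chain T μ b j ∧ b ∈ blockOf T μ j ∧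
        hyp n a b ((T.drift a : ℝ) - (T.drift b : ℝ)) ∈ multiCat n mv := by
      by_contra hno
      push Not at hno
      have : Chain T μ i j := by
        clear hji hstep hi hd hc
        induction hcon with
        | refl => exact .refl
        | tail _ h ih =>
          by_contra hb
          exact hno _ _ ih hb h.2.1 h.2.2
      exact hc.1.ne (this.antisymm hji.path_isPrefix)
    obtain ⟨a, b, ha, hb, hbB, hab⟩ := cross
    have hjb : Chain T μ j b := by
      rcases chain_or_chain_of_top_eq hμ ((simMu_iff hμ).mp hbB) with h | h
      · exact h
      · exact absurd h hb
    have hib : Chain T μ i b := by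
      rcases Relation.ReflTransGen.cases_head hjb with rfl | ⟨c, hjc, hcb⟩
      · exact absurd .refl hb
      · exact (hstep.right_unique hμ hjc) ▸ hcb
    have hne : b ≠ a := by rintro rfl; exact hb ha
    rw [hyp_drift_swap, hyp_drift_mem hne (ha.drift_le.trans hjb.drift_le)] at hab
    have := hib.drift_le
    exact ⟨a, ha, by omega⟩
  · rcases hC i j s hc hi with ⟨rfl, -⟩ | ⟨i', j', hi', hj', hmem⟩
    · exact ⟨j, .refl, by omega⟩
    · have h1 : Chain T μ i i' := by
        rw [simMu_iff hμ, top_eq_self hμ hi] at hi'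
        exact hi' ▸ (top_spec hμ i').1
      have h2 : Chain T μ j' j := by
        rcases chain_or_chain_of_top_eq hμ ((simMu_iff hμ).mp hj') with h | h
        · exact h
        · rcases Relation.ReflTransGen.cases_head h with rfl | ⟨c, ⟨hcμ, t, hct⟩, -⟩
          · exact .refl
          · have h3 := (hμ.cadet hcμ hct).1.le_of_isChild hc.1
            obtain rfl := le_antisymm h3 (hc.le_of_isChild hct)
            exact absurd (hct.child_unique hc.1 ▸ hcμ) hi
      have h3 := h1.drift_le
      have h4 := h2.drift_le
      have hne : i' ≠ j' := by
        rintro rfl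
        have hl1 := h1.path_isPrefix.length_le
        have hl2 := h2.path_isPrefix.length_le
        rw [hc.1] at hl1
        simp at hl1
        omega
      rw [hyp_drift_mem hne (by omega)] at hmem
      exact ⟨j', h2, by omega⟩

theorem OTset_eq_reachTrees : OTset m n (multiCat n mv) = reachTrees m n mv := by
  ext ⟨T, μ⟩
  rw [mem_reachTrees_iff]
  refine and_congr_right fun hμ => ⟨fun h => reachCond_of_aConnected hμ h.1 h.2, fun h => ?_⟩
  exact ⟨h.aConnected hμ, h.cadetCond⟩

end Reach

section Compat

variable {m n : ℕ} {T : LTree m n} {μ : Set (Fin n)} {mv : Fin n → ℕ}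

/-- The comparisons of `x i` with `x j + s` for `s ≤ mv j` agree with those of drifts, ties being
broken by the order on blocks. -/
def Compat (mv : Fin n → ℕ) (T : LTree m n) (μ : Set (Fin n)) (x : Fin n → ℝ) : Prop :=
  ∀ i j, ∀ s : ℕ, s ≤ mv j →
    (x i < x j + s ↔ T.drift i < T.drift j + s ∨
      (T.drift i = T.drift j + s ∧ key T μ i < key T μ j)) ∧
    (x i = x j + s ↔ T.drift i = T.drift j + s ∧ key T μ i = key T μ j)

theorem Compat.gt_iff {x : Fin n → ℝ} (h : Compat mv T μ x) {i j : Fin n} {s : ℕ}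
    (hs : s ≤ mv j) : x j + s < x i ↔ T.drift j + s < T.drift i ∨
      (T.drift i = T.drift j + s ∧ key T μ j < key T μ i) := by
  obtain ⟨h1, h2⟩ := h i j s hs
  rw [← not_le, le_iff_lt_or_eq, h1, h2]
  rcases lt_trichotomy (T.drift i) (T.drift j + s) with h | h | h
  · simp [h, h.ne, h.not_gt]
  · rcases lt_trichotomy (key T μ i) (key T μ j) with h' | h' | h'
    · simp [h, h', h'.not_gt]
    · simp [h, h']
    · simp [h, h', h'.not_gt, h'.ne']
  · simp [h, h.ne', h.not_gt]

theorem Compat.eq_signClass {y : Fin n → ℝ} (h : Compat mv T μ y) :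
    {x | Compat mv T μ x} = signClass mv y := by
  ext x
  constructor
  · intro hx i j _ s hs
    exact ⟨(hx i j s hs).1.trans (h i j s hs).1.symm, (hx i j s hs).2.trans (h i j s hs).2.symm⟩
  · intro hx i j s hs
    by_cases hij : i = j
    · subst hij
      rw [← (h i i s hs).1, ← (h i i s hs).2]
      simp
    · exact ⟨(hx i j hij s hs).1.trans (h i j s hs).1, (hx i j hij s hs).2.trans (h i j s hs).2⟩

open Classical in
theorem exists_compat (mv : Fin n → ℕ) (T : LTree m n) (μ : Set (Fin n)) :
    ∃ x, Compat mv T μ x := by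
  let rank : Fin n → ℕ := fun i => (Finset.univ.filter fun k => key T μ k < key T μ i).card
  have hrank : ∀ i j, key T μ i < key T μ j → rank i < rank j := by
    intro i j h
    refine Finset.card_lt_card (Finset.ssubset_iff_subset_ne.mpr ⟨?_, fun e => ?_⟩)
    · intro k; simp only [Finset.mem_filter, Finset.mem_univ, true_and]; exact fun hk => hk.trans h
    · have : i ∈ Finset.univ.filter fun k => key T μ k < key T μ j := by simpa using h
      rw [← e] at this
      simp at this
  have hle : ∀ i, rank i ≤ n := fun i => (Finset.card_le_univ _).trans (by simp)
  let x : Fin n → ℝ := fun i => T.drift i + rank i / (n + 1)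
  have hn : (0 : ℝ) < n + 1 := by positivity
  have lt1 : ∀ i, (rank i : ℝ) / (n + 1) < 1 := fun i => by
    rw [div_lt_one hn]; exact_mod_cast Nat.lt_succ_of_le (hle i)
  have ge0 : ∀ i, (0 : ℝ) ≤ rank i / (n + 1) := fun i => by positivity
  have hlt : ∀ i j, ∀ s : ℤ, (T.drift i < T.drift j + s ∨
      (T.drift i = T.drift j + s ∧ key T μ i < key T μ j)) → x i < x j + s := by
    rintro i j s (h | ⟨h, h'⟩)
    · have h : (T.drift i : ℝ) + 1 ≤ T.drift j + s := by exact_mod_cast h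
      have := lt1 i
      have := ge0 j
      simp only [x]; linarith
    · have h : (T.drift i : ℝ) = T.drift j + s := by exact_mod_cast h
      have : (rank i : ℝ) / (n + 1) < rank j / (n + 1) := by
        have : (rank i : ℝ) < rank j := by exact_mod_cast hrank i j h'
        gcongr
      simp only [x]; linarith
  have heq : ∀ i j, ∀ s : ℕ, T.drift i = T.drift j + s → key T μ i = key T μ j →
      x i = x j + s := by
    intro i j s h h'
    have hr : rank i = rank j := by simp only [rank, h']
    have h : (T.drift i : ℝ) = T.drift j + s := by exact_mod_cast h
    simp only [x, hr, h]; ring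
  refine ⟨x, fun i j s _ => ?_⟩
  have h1 := hlt i j s
  have h2 := hlt j i (-s)
  have h3 := heq i j s
  simp only [Int.cast_neg, Int.cast_natCast] at h1 h2
  have tri : (T.drift i < T.drift j + s ∨ (T.drift i = T.drift j + s ∧ key T μ i < key T μ j)) ∨
      (T.drift i = T.drift j + s ∧ key T μ i = key T μ j) ∨
      ((T.drift j : ℤ) < T.drift i + -s ∨
        ((T.drift j : ℤ) = T.drift i + -s ∧ key T μ j < key T μ i)) := by
    rcases lt_trichotomy (T.drift i) (T.drift j + s) with h | h | h
    · exact Or.inl (Or.inl h)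
    · rcases lt_trichotomy (key T μ i) (key T μ j) with h' | h' | h'
      · exact Or.inl (Or.inr ⟨h, h'⟩)
      · exact Or.inr (Or.inl ⟨h, h'⟩)
      · exact Or.inr (Or.inr (Or.inr ⟨by omega, h'⟩))
    · exact Or.inr (Or.inr (Or.inl (by omega)))
  rcases tri with h | h | h
  · have hx := h1 (by exact_mod_cast h)
    refine ⟨iff_of_true hx h, iff_of_false hx.ne ?_⟩
    rintro ⟨ha, hb⟩
    rcases h with h | ⟨-, h⟩
    · omega
    · exact h.ne hb
  · have hx := h3 h.1 h.2
    refine ⟨iff_of_false hx.not_lt ?_, iff_of_true hx h⟩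
    rintro (h' | ⟨-, h'⟩)
    · omega
    · exact h'.ne h.2
  · have hx : x j + s < x i := by have := h2 h; linarith
    refine ⟨iff_of_false hx.not_gt ?_, iff_of_false hx.ne' ?_⟩
    · rintro (h' | ⟨h', h''⟩) <;> rcases h with h | ⟨h, h0⟩
      · omega
      · omega
      · omega
      · exact lt_asymm h0 h''
    · rintro ⟨h', h''⟩
      rcases h with h | ⟨h, h0⟩
      · omega
      · exact h0.ne' h''

theorem vlt_child_iff (hμ : IsMarking T μ) {i j : Fin n} (hne : top T μ i ≠ top T μ j) (s : ℕ) :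
    vlt (T.path i) (T.path j ++ [s]) ↔ T.drift i < T.drift j + s ∨
      (T.drift i = T.drift j + s ∧ key T μ i < key T μ j) := by
  rw [vlt_iff]
  have h1 : (T.path j ++ [s]).sum = T.drift j + s := by simp [LTree.drift]
  rw [h1]
  exact or_congr Iff.rfl (and_congr_right fun h => enc_path_lt_iff_key_lt hμ hne h)

theorem vge_child_iff (hμ : IsMarking T μ) {i j : Fin n} (hne : top T μ i ≠ top T μ j) (s : ℕ) :
    vge (T.path i) (T.path j ++ [s]) ↔ T.drift j + s < T.drift i ∨
      (T.drift i = T.drift j + s ∧ key T μ j < key T μ i) := by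
  rw [vge_iff]
  have h1 : (T.path j ++ [s]).sum = T.drift j + s := by simp [LTree.drift]
  rw [h1]
  refine or_congr Iff.rfl ?_
  rw [eq_comm]
  refine and_congr_right fun h => ?_
  rw [← not_lt, enc_path_lt_iff_key_lt hμ hne h, not_lt]
  exact ⟨fun h => lt_of_le_of_ne h fun e => hne (key_eq_iff.mp e.symm), le_of_lt⟩

theorem Chain.sub_eq_of_mem_PhiBar {A : Set (Set (Fin n → ℝ))} {x : Fin n → ℝ}
    (hx : x ∈ PhiBar m n A T μ) {a i : Fin n} (h : Chain T μ a i) :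
    x i = x a + (T.drift i - T.drift a) := by
  induction h with
  | refl => simp
  | tail _ h ih =>
    obtain ⟨hc, s, hs⟩ := h
    have h1 := hx.1 _ hc _ s hs
    rw [hs.drift_eq]; push_cast; linarith

theorem compat_of_mem_PhiBar (hμ : IsMarking T μ) (hm : ∀ i, mv i ≤ m) {x : Fin n → ℝ}
    (hx : x ∈ PhiBar m n (multiCat n mv) T μ) : Compat mv T μ x := by
  intro i j s hs
  by_cases ht : top T μ i = top T μ j
  · have hk := key_eq_iff.mpr ht
    have hd : x i = x j + (T.drift i - T.drift j) := by
      rcases chain_or_chain_of_top_eq hμ ht with h | h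
      · have := h.sub_eq_of_mem_PhiBar hx; linarith
      · exact h.sub_eq_of_mem_PhiBar hx
    simp only [hk, lt_irrefl, and_false, or_false, and_true]
    rw [hd, ← Nat.cast_inj (R := ℝ), ← Nat.cast_lt (α := ℝ)]
    push_cast
    constructor <;> constructor <;> intro h <;> linarith
  · have hij : i ≠ j := fun e => ht (by rw [e])
    have hkne : key T μ i ≠ key T μ j := fun e => ht (key_eq_iff.mp e)
    simp only [hkne, and_false, iff_false]
    have concl : ∀ P Q : Prop, (P → x i < x j + s) → (Q → x j + s < x i) → (P ∨ Q) →
        (x i < x j + s ↔ P) ∧ ¬ x i = x j + s := by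
      rintro P Q h1 h2 (h | h)
      · exact ⟨iff_of_true (h1 h) h, (h1 h).ne⟩
      · exact ⟨iff_of_false (h2 h).not_gt fun h' => (h2 h).not_gt (h1 h'), (h2 h).ne'⟩
    refine concl _ (T.drift j + s < T.drift i ∨
      (T.drift i = T.drift j + s ∧ key T μ j < key T μ i)) ?_ ?_ ?_
    · intro h
      by_cases h0 : 0 < s ∨ j < i
      · have := (hx.2 i j s ⟨⟨hs.trans (hm j), hij, h0⟩, (hyp_mem_multiCat hij s).mpr hs⟩
          (mt (simMu_iff hμ).mp ht)).1 ((vlt_child_iff hμ ht s).mpr h)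
        linarith
      · obtain rfl : s = 0 := by omega
        have := (hx.2 j i 0 ⟨⟨by omega, hij.symm, by omega⟩,
          (hyp_mem_multiCat hij.symm 0).mpr (Nat.zero_le _)⟩
          (mt (simMu_iff hμ).mp (Ne.symm ht))).2 ((vge_child_iff hμ (Ne.symm ht) 0).mpr
            (h.imp (by omega) fun h => ⟨by omega, h.2⟩))
        simp at this ⊢
        exact this
    · intro h
      by_cases h0 : 0 < s ∨ j < i
      · have := (hx.2 i j s ⟨⟨hs.trans (hm j), hij, h0⟩, (hyp_mem_multiCat hij s).mpr hs⟩
          (mt (simMu_iff hμ).mp ht)).2 ((vge_child_iff hμ ht s).mpr h)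
        linarith
      · obtain rfl : s = 0 := by omega
        have := (hx.2 j i 0 ⟨⟨by omega, hij.symm, by omega⟩,
          (hyp_mem_multiCat hij.symm 0).mpr (Nat.zero_le _)⟩
          (mt (simMu_iff hμ).mp (Ne.symm ht))).1 ((vlt_child_iff hμ (Ne.symm ht) 0).mpr
            (h.imp (by omega) fun h => ⟨by omega, h.2⟩))
        simp at this ⊢
        exact this
    · rcases lt_trichotomy (T.drift i) (T.drift j + s) with h | h | h
      · exact Or.inl (Or.inl h)
      · rcases lt_or_gt_of_ne hkne with h' | h'
        · exact Or.inl (Or.inr ⟨h, h'⟩)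
        · exact Or.inr (Or.inr ⟨h, h'⟩)
      · exact Or.inr (Or.inl h)

theorem Compat.sub_eq_of_chain (hμ : IsMarking T μ) {x : Fin n → ℝ} (h : Compat mv T μ x)
    {k j : Fin n} (hk : Chain T μ k j) (hd : T.drift j ≤ mv k + T.drift k) :
    x j = x k + (T.drift j - T.drift k) := by
  have h1 := hk.drift_le
  have := ((h j k (T.drift j - T.drift k) (by omega)).2).mpr ⟨by omega, hk.key_eq hμ⟩
  rwa [Nat.cast_sub h1] at this

theorem Compat.mem_PhiBar (hμ : IsMarking T μ) (hr : ReachCond mv T μ)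
    {x : Fin n → ℝ} (h : Compat mv T μ x) : x ∈ PhiBar m n (multiCat n mv) T μ := by
  constructor
  · intro i hi j s hc
    obtain ⟨k, hk, hks⟩ := hr i j s hc
    have hd := hc.drift_eq
    have h1 := h.sub_eq_of_chain hμ hk (by omega)
    have h2 := h.sub_eq_of_chain hμ (hk.tail ⟨hi, s, hc⟩) (by omega)
    rw [h1, h2, hd]; push_cast; ring
  · rintro i j s ⟨⟨hsm, hij, -⟩, hmem⟩ hsim
    rw [hyp_mem_multiCat hij] at hmem
    have ht : top T μ i ≠ top T μ j := mt (simMu_iff hμ).mpr hsim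
    rw [vlt_child_iff hμ ht, vge_child_iff hμ ht, ← h.gt_iff hmem, ← (h i j s hmem).1]
    constructor <;> intro h <;> linarith

theorem PhiBar_eq (hμ : IsMarking T μ) (hr : ReachCond mv T μ) (hm : ∀ i, mv i ≤ m) :
    PhiBar m n (multiCat n mv) T μ = {x | Compat mv T μ x} :=
  Set.Subset.antisymm (fun _ hx => compat_of_mem_PhiBar hμ hm hx) fun _ hx =>
    Compat.mem_PhiBar hμ hr hx

end Compat

section Position

variable {n : ℕ} {mv : Fin n → ℕ} {x : Fin n → ℝ}

/-- Nodes ordered by coordinate, ties being broken by label. -/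
def pos (x : Fin n → ℝ) (i : Fin n) : ℝ ×ₗ Fin n := toLex (x i, i)

theorem pos_injective (x : Fin n → ℝ) : Function.Injective (pos x) := fun _ _ h =>
  congrArg Prod.snd (toLex.injective h)

theorem pos_lt_iff {i j : Fin n} : pos x i < pos x j ↔ x i < x j ∨ x i = x j ∧ i < j :=
  Prod.Lex.toLex_lt_toLex

theorem pos_le_iff {i j : Fin n} : pos x i ≤ pos x j ↔ x i < x j ∨ x i = x j ∧ i ≤ j :=
  Prod.Lex.toLex_le_toLex

theorem le_of_pos_le {i j : Fin n} (h : pos x i ≤ pos x j) : x i ≤ x j := by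
  rcases pos_le_iff.mp h with h | h
  · exact h.le
  · exact h.1.le

theorem pos_lt_of_lt {i j : Fin n} (h : x i < x j) : pos x i < pos x j :=
  pos_lt_iff.mpr (Or.inl h)

/-- `i` should be the `s`-child of `j` in the tree associated with `x`: the value `x j + s` is the
largest of the form `x l + t ≤ x i` with `t ≤ mv l` and `l` before `i`, and `j` is the last node
before `i` from which this value is reached by a nonnegative integer. -/
structure IsPar (mv : Fin n → ℕ) (x : Fin n → ℝ) (i j : Fin n) (s : ℕ) : Prop where
  lt : pos x j < pos x i
  slot : ∃ k, ∃ t : ℕ, t ≤ mv k ∧ pos x k ≤ pos x j ∧ x k + t = x j + s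
  le : x j + s ≤ x i
  max : ∀ l, ∀ t : ℕ, t ≤ mv l → pos x l < pos x i → x l + t ≤ x i → x l + t ≤ x j + s
  last : ∀ l, ∀ t : ℕ, pos x l < pos x i → x l + t = x j + s → pos x l ≤ pos x j

theorem IsPar.value_le {i j j' : Fin n} {s s' : ℕ} (h : IsPar mv x i j s)
    (h' : IsPar mv x i j' s') : x j + s ≤ x j' + s' := by
  obtain ⟨k, t, ht, hk, he⟩ := h.slot
  rw [← he]
  exact h'.max k t ht (hk.trans_lt h.lt) (he ▸ h.le)

theorem IsPar.unique {i j j' : Fin n} {s s' : ℕ} (h : IsPar mv x i j s)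
    (h' : IsPar mv x i j' s') : j = j' ∧ s = s' := by
  have hv := le_antisymm (h.value_le h') (h'.value_le h)
  obtain rfl : j = j' := pos_injective x
    (le_antisymm (h'.last j s h.lt hv) (h.last j' s' h'.lt hv.symm))
  refine ⟨rfl, ?_⟩
  exact_mod_cast add_left_cancel hv

theorem IsPar.child_unique {i i' j : Fin n} {s : ℕ} (h : IsPar mv x i j s)
    (h' : IsPar mv x i' j s) : i = i' := by
  have key : ∀ a b, IsPar mv x a j s → IsPar mv x b j s → ¬ pos x a < pos x b := by
    intro a b ha hb hab
    have h1 := hb.max a 0 (Nat.zero_le _) hab (by simpa using le_of_pos_le hab.le)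
    have h2 : x a = x j + s := le_antisymm (by simpa using h1) ha.le
    exact absurd (hb.last a 0 hab (by simpa using h2)) ha.lt.not_ge
  exact pos_injective x (le_antisymm (not_lt.mp (key i' i h' h)) (not_lt.mp (key i i' h h')))

theorem IsPar.exists_le {i j : Fin n} {s : ℕ} (h : IsPar mv x i j s) : ∃ k, s ≤ mv k := by
  obtain ⟨k, t, ht, hk, he⟩ := h.slot
  have := le_of_pos_le hk
  have : (s : ℝ) ≤ t := by linarith
  exact ⟨k, (Nat.cast_le.mp this).trans ht⟩

theorem exists_isPar (mv : Fin n → ℕ) {i l : Fin n} (hl : pos x l < pos x i) :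
    ∃ j s, IsPar mv x i j s := by
  classical
  let C : Finset (Σ _ : Fin n, ℕ) := (Finset.univ.sigma fun l => Finset.range (mv l + 1)).filter
    fun p => pos x p.1 < pos x i ∧ x p.1 + p.2 ≤ x i
  have hC : ∀ l t, (⟨l, t⟩ : Σ _ : Fin n, ℕ) ∈ C ↔ t ≤ mv l ∧ pos x l < pos x i ∧ x l + t ≤ x i := by
    intro l t
    simp [C]
  obtain ⟨⟨k, t⟩, hk, hkmax⟩ := C.exists_max_image (fun p => x p.1 + p.2)
    ⟨⟨l, 0⟩, (hC l 0).mpr ⟨Nat.zero_le _, hl, by simpa using le_of_pos_le hl.le⟩⟩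
  rw [hC] at hk
  let D : Finset (Fin n) := Finset.univ.filter
    fun j => pos x j < pos x i ∧ ∃ s : ℕ, x j + s = x k + t
  obtain ⟨j, hj, hjmax⟩ := D.exists_max_image (pos x) ⟨k, by simp [D, hk.2.1]⟩
  simp only [D, Finset.mem_filter, Finset.mem_univ, true_and] at hj hjmax
  obtain ⟨hji, s, hs⟩ := hj
  refine ⟨j, s, hji, ⟨k, t, hk.1, hjmax k ⟨hk.2.1, t, rfl⟩, hs.symm⟩, hs ▸ hk.2.2, ?_, ?_⟩
  · intro l t ht hl hle
    rw [hs]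
    exact hkmax ⟨l, t⟩ ((hC l t).mpr ⟨ht, hl, hle⟩)
  · intro l t hl he
    exact hjmax l ⟨hl, t, he.trans hs⟩

end Position

section Uniqueness

variable {m n : ℕ} {T : LTree m n} {μ : Set (Fin n)} {mv : Fin n → ℕ} {x : Fin n → ℝ}

theorem Compat.pos_le_of_chain (hμ : IsMarking T μ) (h : Compat mv T μ x) {a b : Fin n}
    (hab : Chain T μ a b) : pos x a ≤ pos x b := by
  have h0 := h a b 0 (Nat.zero_le _)
  simp only [Nat.cast_zero, add_zero] at h0
  rw [pos_le_iff, h0.1, h0.2]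
  rcases hab.lt_or_le hμ with h | h
  · exact Or.inl (Or.inl h)
  · exact Or.inr ⟨⟨h.1, (hab.key_eq hμ).symm⟩, h.2⟩

theorem Compat.exists_slot (hμ : IsMarking T μ) (hr : ReachCond mv T μ) (h : Compat mv T μ x)
    {i j : Fin n} {s : ℕ} (hc : T.IsChild i j s) :
    ∃ k, ∃ t : ℕ, t ≤ mv k ∧ Chain T μ k j ∧ x k + t = x j + s ∧ T.drift i = T.drift k + t := by
  obtain ⟨k, hk, hks⟩ := hr i j s hc
  have h1 := hk.drift_le
  have hd := hc.drift_eq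
  have h2 := h.sub_eq_of_chain hμ hk (by omega)
  refine ⟨k, T.drift j + s - T.drift k, by omega, hk, ?_, by omega⟩
  rw [h2, Nat.cast_sub (by omega)]
  push_cast; ring

theorem Compat.eq_of_mem (hμ : IsMarking T μ) (hr : ReachCond mv T μ) (h : Compat mv T μ x)
    {i j : Fin n} {s : ℕ} (hc : T.IsChild i j s) (hi : i ∈ μ) : x i = x j + s := by
  obtain ⟨k, t, ht, hk, he, hd⟩ := h.exists_slot hμ hr hc
  rw [← he]
  exact (h i k t ht).2.mpr ⟨hd, Chain.key_eq hμ (hk.tail ⟨hi, s, hc⟩)⟩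

theorem Compat.lt_of_notMem (hμ : IsMarking T μ) (hr : ReachCond mv T μ) (h : Compat mv T μ x)
    {i j : Fin n} {s : ℕ} (hc : T.IsChild i j s) (hi : i ∉ μ) : x j + s < x i := by
  obtain ⟨k, t, ht, hk, he, hd⟩ := h.exists_slot hμ hr hc
  rw [← he, h.gt_iff ht]
  exact Or.inr ⟨hd, hk.key_eq hμ ▸ key_lt_of_isChild hμ hi hc⟩

theorem Compat.pos_lt_of_isChild (hμ : IsMarking T μ) (hr : ReachCond mv T μ)
    (h : Compat mv T μ x) {i j : Fin n} {s : ℕ} (hc : T.IsChild i j s) : pos x j < pos x i := by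
  by_cases hi : i ∈ μ
  · exact lt_of_le_of_ne (h.pos_le_of_chain hμ (.single ⟨hi, s, hc⟩))
      fun e => hc.ne (pos_injective x e).symm
  · have := h.lt_of_notMem hμ hr hc hi
    have : (0 : ℝ) ≤ s := Nat.cast_nonneg s
    exact pos_lt_of_lt (by linarith)

theorem Compat.isPar (hμ : IsMarking T μ) (hr : ReachCond mv T μ) (h : Compat mv T μ x)
    {i j : Fin n} {s : ℕ} (hc : T.IsChild i j s) : IsPar mv x i j s := by
  obtain ⟨k, t, ht, hk, he, hd⟩ := h.exists_slot hμ hr hc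
  refine ⟨h.pos_lt_of_isChild hμ hr hc, ⟨k, t, ht, h.pos_le_of_chain hμ hk, he⟩, ?_, ?_, ?_⟩
  · by_cases hi : i ∈ μ
    · exact (h.eq_of_mem hμ hr hc hi).ge
    · exact (h.lt_of_notMem hμ hr hc hi).le
  · intro l u hu hl hle
    by_cases hi : i ∈ μ
    · rwa [← h.eq_of_mem hμ hr hc hi]
    · by_contra hlt
      rw [not_le, ← he] at hlt
      have h1 := (h i l u hu).1.not.mp hle.not_gt
      push Not at h1
      have h2 : T.drift k + t < T.drift l + u ∨
          (T.drift k + t = T.drift l + u ∧ key T μ k < key T μ l) := by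
        rcases le_total u t with hut | hut
        · have := (h.gt_iff (i := l) (j := k) (s := t - u) (by omega)).mp (by
            rw [Nat.cast_sub hut]; linarith)
          exact this.imp (by omega) fun h => ⟨by omega, h.2⟩
        · have := (h k l (u - t) (by omega)).1.mp (by
            rw [Nat.cast_sub hut]; linarith)
          exact this.imp (by omega) fun h => ⟨by omega, h.2⟩
      rcases h2 with h2 | ⟨h2, h3⟩
      · omega
      · rcases (h1.2 (by omega)).lt_or_eq with h4 | h4
        · have := key_le_of_key_lt hμ hi hc (by omega) h4
          rw [hk.key_eq hμ] at this
          exact h3.not_ge this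
        · have h5 := key_eq_iff.mp h4
          rw [top_eq_self hμ hi] at h5
          exact hl.not_ge (h.pos_le_of_chain hμ (h5 ▸ (top_spec hμ l).1))
  · intro l u hl hlu
    by_contra hjl
    rw [not_le] at hjl
    have hkl := le_of_pos_le ((h.pos_le_of_chain hμ hk).trans hjl.le)
    have hut : u ≤ t := by
      have : (u : ℝ) ≤ t := by linarith
      exact_mod_cast this
    obtain ⟨h1, h2⟩ := (h l k (t - u) (by omega)).2.mp (by rw [Nat.cast_sub hut]; linarith)
    rw [← hk.key_eq hμ, key_eq_iff] at h2
    rcases chain_or_chain_of_top_eq hμ h2 with h3 | h3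
    · exact hjl.not_ge (h.pos_le_of_chain hμ h3)
    · rcases Relation.ReflTransGen.cases_head h3 with rfl | ⟨c, ⟨hcμ, s', hc'⟩, hcl⟩
      · exact lt_irrefl _ hjl
      · have h4 := (hμ.cadet hcμ hc').1.le_of_isChild hc
        have h5 := Chain.drift_le hcl
        have h6 := hc'.drift_eq
        have h7 := hc.drift_eq
        obtain rfl : s = s' := by omega
        obtain rfl := hc'.child_unique hc
        exact hl.not_ge (h.pos_le_of_chain hμ hcl)

theorem Compat.pos_root_le (hμ : IsMarking T μ) (hr : ReachCond mv T μ) (h : Compat mv T μ x)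
    {i : Fin n} (hi : T.path i = []) (j : Fin n) : pos x i ≤ pos x j := by
  induction hl : (T.path j).length using Nat.strong_induction_on generalizing j with
  | _ l ih =>
    by_cases hj : T.path j = []
    · rw [T.inj (hi.trans hj.symm)]
    · obtain ⟨k, s, hc⟩ := T.exists_parent hj
      refine (ih _ ?_ k rfl).trans (h.pos_lt_of_isChild hμ hr hc).le
      rw [← hl, hc]; simp

theorem LTree.ext_path {T T' : LTree m n} (h : ∀ i, T.path i = T'.path i) : T = T' := by
  obtain ⟨p, _, _, _⟩ := T
  obtain ⟨p', _, _, _⟩ := T'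
  obtain rfl : p = p' := funext h
  rfl

theorem Compat.tree_unique {T' : LTree m n} {μ' : Set (Fin n)} (hμ : IsMarking T μ)
    (hr : ReachCond mv T μ) (h : Compat mv T μ x) (hμ' : IsMarking T' μ')
    (hr' : ReachCond mv T' μ') (h' : Compat mv T' μ' x) : T = T' ∧ μ = μ' := by
  have hT : T = T' := by
    refine LTree.ext_path fun i => ?_
    induction hl : (T.path i).length using Nat.strong_induction_on generalizing i with
    | _ l ih =>
      by_cases hi : T.path i = []
      · by_cases hi' : T'.path i = []
        · rw [hi, hi']
        · obtain ⟨j, s, hc⟩ := T'.exists_parent hi'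
          exact absurd (h.pos_root_le hμ hr hi j) (h'.pos_lt_of_isChild hμ' hr' hc).not_ge
      · obtain ⟨j, s, hc⟩ := T.exists_parent hi
        by_cases hi' : T'.path i = []
        · exact absurd (h'.pos_root_le hμ' hr' hi' j) (h.pos_lt_of_isChild hμ hr hc).not_ge
        · obtain ⟨j', s', hc'⟩ := T'.exists_parent hi'
          obtain ⟨rfl, rfl⟩ := (h.isPar hμ hr hc).unique (h'.isPar hμ' hr' hc')
          rw [hc, hc', ih _ (by rw [← hl, hc]; simp) j rfl]
  subst hT
  refine ⟨rfl, Set.ext fun i => ⟨fun hi => ?_, fun hi => ?_⟩⟩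
  · obtain ⟨j, s, hc, -⟩ := hμ i hi
    by_contra hi'
    exact (h'.lt_of_notMem hμ' hr' hc.1 hi').ne' (h.eq_of_mem hμ hr hc.1 hi)
  · obtain ⟨j, s, hc, -⟩ := hμ' i hi
    by_contra hi'
    exact (h.lt_of_notMem hμ hr hc.1 hi').ne' (h'.eq_of_mem hμ' hr' hc.1 hi)

end Uniqueness

section Construction

variable {n : ℕ} {mv : Fin n → ℕ} {x : Fin n → ℝ}

open Classical in
/-- The number of nodes before `i`. -/
noncomputable def posRank (x : Fin n → ℝ) (i : Fin n) : ℕ :=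
  (Finset.univ.filter fun j => pos x j < pos x i).card

theorem posRank_lt {i j : Fin n} (h : pos x i < pos x j) : posRank x i < posRank x j := by
  classical
  refine Finset.card_lt_card (Finset.ssubset_iff_subset_ne.mpr ⟨fun k => ?_, fun e => ?_⟩)
  · simp only [Finset.mem_filter, Finset.mem_univ, true_and]; exact fun hk => hk.trans h
  · have : i ∈ Finset.univ.filter fun k => pos x k < pos x j := by simpa using h
    rw [← e] at this
    simp at this

open Classical in
/-- The root-to-node paths of the tree associated with `x`. -/
noncomputable def pointPath (mv : Fin n → ℕ) (x : Fin n → ℝ) (i : Fin n) : List ℕ :=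
  if h : ∃ p : Fin n × ℕ, IsPar mv x i p.1 p.2 then
    pointPath mv x h.choose.1 ++ [h.choose.2]
  else []
termination_by posRank x i
decreasing_by exact posRank_lt h.choose_spec.lt

theorem IsPar.pointPath_eq {i j : Fin n} {s : ℕ} (h : IsPar mv x i j s) :
    pointPath mv x i = pointPath mv x j ++ [s] := by
  have hex : ∃ p : Fin n × ℕ, IsPar mv x i p.1 p.2 := ⟨(j, s), h⟩
  obtain ⟨h1, h2⟩ := hex.choose_spec.unique h
  rw [pointPath, dif_pos hex, h1, h2]

theorem exists_isPar_of_pointPath_ne {i : Fin n} (h : pointPath mv x i ≠ []) :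
    ∃ j s, IsPar mv x i j s := by
  by_contra hno
  rw [pointPath, dif_neg (fun ⟨p, hp⟩ => hno ⟨p.1, p.2, hp⟩)] at h
  exact h rfl

theorem pos_le_of_pointPath_eq_nil {i : Fin n} (h : pointPath mv x i = []) (j : Fin n) :
    pos x i ≤ pos x j := by
  by_contra hlt
  obtain ⟨k, s, hk⟩ := exists_isPar mv (not_le.mp hlt)
  rw [hk.pointPath_eq] at h
  simp at h

theorem pointPath_injective (mv : Fin n → ℕ) (x : Fin n → ℝ) :
    Function.Injective (pointPath mv x) := by
  intro i
  induction hl : (pointPath mv x i).length using Nat.strong_induction_on generalizing i with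
  | _ l ih =>
    intro i' h
    by_cases hi : pointPath mv x i = []
    · exact pos_injective x (le_antisymm (pos_le_of_pointPath_eq_nil hi i')
        (pos_le_of_pointPath_eq_nil (h ▸ hi) i))
    · obtain ⟨j, s, hj⟩ := exists_isPar_of_pointPath_ne hi
      obtain ⟨j', s', hj'⟩ := exists_isPar_of_pointPath_ne (h ▸ hi)
      rw [hj.pointPath_eq, hj'.pointPath_eq] at h
      obtain ⟨h1, h2⟩ := List.append_inj' h rfl
      obtain rfl : s = s' := (List.cons.inj h2).1
      obtain rfl := ih _ (by rw [← hl, hj.pointPath_eq]; simp) rfl h1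
      exact hj.child_unique hj'

/-- The tree associated with the point `x`. -/
noncomputable def pointTree (mv : Fin n → ℕ) (m : ℕ) (hm : ∀ i, mv i ≤ m) (x : Fin n → ℝ) :
    LTree m n where
  path := pointPath mv x
  entry_le := by
    intro i
    induction hl : (pointPath mv x i).length using Nat.strong_induction_on generalizing i with
    | _ l ih =>
      by_cases hi : pointPath mv x i = []
      · simp [hi]
      · obtain ⟨j, s, hj⟩ := exists_isPar_of_pointPath_ne hi
        obtain ⟨k, hk⟩ := hj.exists_le
        intro t ht
        rw [hj.pointPath_eq, List.mem_append, List.mem_singleton] at ht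
        rcases ht with ht | rfl
        · exact ih _ (by rw [← hl, hj.pointPath_eq]; simp) j rfl t ht
        · exact hk.trans (hm k)
  inj := pointPath_injective mv x
  parent_closed := by
    intro i hi
    obtain ⟨j, s, hj⟩ := exists_isPar_of_pointPath_ne hi
    exact ⟨j, by rw [hj.pointPath_eq, List.dropLast_concat]⟩

/-- The marked nodes of the tree associated with `x`. -/
def pointMarks (mv : Fin n → ℕ) (x : Fin n → ℝ) : Set (Fin n) :=
  {i | ∃ j s, IsPar mv x i j s ∧ x i = x j + s}

variable {m : ℕ} {hm : ∀ i, mv i ≤ m}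

theorem pointTree_isChild_iff {i j : Fin n} {s : ℕ} :
    (pointTree mv m hm x).IsChild i j s ↔ IsPar mv x i j s := by
  constructor
  · intro h
    obtain ⟨j', s', h'⟩ := exists_isPar_of_pointPath_ne (mv := mv) (x := x) (i := i) (by
      intro e
      have h : pointPath mv x i = pointPath mv x j ++ [s] := h
      rw [e] at h
      simp at h)
    have hc : (pointTree mv m hm x).IsChild i j' s' := h'.pointPath_eq
    obtain ⟨rfl, rfl⟩ := h.parent_unique hc
    exact h'
  · exact fun h => h.pointPath_eq

theorem mem_pointMarks_iff {i j : Fin n} {s : ℕ} (h : IsPar mv x i j s) :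
    i ∈ pointMarks mv x ↔ x i = x j + s := by
  constructor
  · rintro ⟨j', s', h', he⟩
    obtain ⟨rfl, rfl⟩ := h.unique h'
    exact he
  · exact fun he => ⟨j, s, h, he⟩

theorem pointTree_isMarking : IsMarking (pointTree mv m hm x) (pointMarks mv x) := by
  rintro i ⟨j, s, h, he⟩
  refine ⟨j, s, ⟨pointTree_isChild_iff.mpr h, ?_⟩, ?_⟩
  · rintro t hst - ⟨i', hi'⟩
    rw [pointTree_isChild_iff] at hi'
    have hst' : (s : ℝ) < t := by exact_mod_cast hst
    have h1 : pos x i < pos x i' := pos_lt_of_lt (by have := hi'.le; linarith)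
    exact (hi'.last i (t - s) h1 (by rw [Nat.cast_sub hst.le]; linarith)).not_gt h.lt
  · rintro rfl
    rcases pos_lt_iff.mp h.lt with h1 | h1
    · simp at he; linarith
    · exact h1.2

/-- Nodes at an integral distance within range are joined by a marked chain. -/
theorem pointTree_chain {k j : Fin n} {t : ℕ} (ht : t ≤ mv k) (hkj : pos x k ≤ pos x j)
    (he : x j = x k + t) : Chain (pointTree mv m hm x) (pointMarks mv x) k j ∧
      (pointTree mv m hm x).drift j = (pointTree mv m hm x).drift k + t := by
  induction hl : posRank x j using Nat.strong_induction_on generalizing j t with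
  | _ l ih =>
    rcases hkj.lt_or_eq with hlt | heq
    · obtain ⟨j', s, hp⟩ := exists_isPar mv hlt
      have hv : x j = x j' + s := le_antisymm (he ▸ hp.max k t ht hlt he.ge) hp.le
      have hkj' : pos x k ≤ pos x j' := hp.last k t hlt (by rw [← he, hv])
      have hst : s ≤ t := by
        have := le_of_pos_le hkj'
        have : (s : ℝ) ≤ t := by linarith
        exact_mod_cast this
      have hc := pointTree_isChild_iff (hm := hm).mpr hp
      obtain ⟨h1, h2⟩ := ih _ (hl ▸ posRank_lt hp.lt) (j := j') (t := t - s) (by omega) hkj'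
        (by rw [Nat.cast_sub hst]; linarith) rfl
      refine ⟨h1.tail ⟨⟨j', s, hp, hv⟩, s, hc⟩, ?_⟩
      rw [hc.drift_eq]; omega
    · obtain rfl := pos_injective x heq
      have : (t : ℝ) = 0 := by linarith
      have : t = 0 := by exact_mod_cast this
      exact ⟨.refl, by omega⟩

theorem IsPar.exists_chain {i j : Fin n} {s : ℕ} (h : IsPar mv x i j s) :
    ∃ k, ∃ t : ℕ, t ≤ mv k ∧ pos x k ≤ pos x j ∧ x k + t = x j + s ∧
      Chain (pointTree mv m hm x) (pointMarks mv x) k j ∧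
      (pointTree mv m hm x).drift i = (pointTree mv m hm x).drift k + t := by
  obtain ⟨k, t, ht, hk, he⟩ := h.slot
  have hst : s ≤ t := by
    have := le_of_pos_le hk
    have : (s : ℝ) ≤ t := by linarith
    exact_mod_cast this
  obtain ⟨h1, h2⟩ := pointTree_chain (hm := hm) (t := t - s) (by omega) hk (by
    rw [Nat.cast_sub hst]; linarith)
  refine ⟨k, t, ht, hk, he, h1, ?_⟩
  rw [(pointTree_isChild_iff.mpr h).drift_eq]; omega

theorem pointTree_reachCond : ReachCond mv (pointTree mv m hm x) (pointMarks mv x) := by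
  intro i j s hc
  obtain ⟨k, t, ht, -, -, h1, h2⟩ := (pointTree_isChild_iff.mp hc).exists_chain (hm := hm)
  exact ⟨k, h1, by rw [← hc.drift_eq]; omega⟩

theorem pos_le_of_pointTree_chain {a b : Fin n}
    (h : Chain (pointTree mv m hm x) (pointMarks mv x) a b) : pos x a ≤ pos x b := by
  induction h with
  | refl => exact le_rfl
  | tail _ h ih =>
    obtain ⟨-, s, hs⟩ := h
    exact ih.trans (pointTree_isChild_iff.mp hs).lt.le

/-- Abstract comparison argument: if each node `i` other than the first is attached to a slot
`(k, t)` which is the last one at or before `x i`, and drifts and keys are compatible with these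
attachments, then they determine all comparisons. -/
theorem compare_of_attached {α : Type*} [LinearOrder α] {d : Fin n → ℕ} {P : Fin n → α}
    (H : ∀ i l, pos x l < pos x i → ∃ k, ∃ t : ℕ, t ≤ mv k ∧ pos x k < pos x i ∧ x k + t ≤ x i ∧
      (∀ l, ∀ u : ℕ, u ≤ mv l → pos x l < pos x i → x l + u ≤ x i → x l + u ≤ x k + t) ∧
      d i = d k + t ∧ ((x i = x k + t ∧ P i = P k) ∨ (x k + t < x i ∧ P k < P i ∧
        ∀ j, pos x j < pos x i → d j ≤ d i → P j ≤ P i → P j ≤ P k)))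
    (i j : Fin n) (s : ℕ) (hs : s ≤ mv j) :
    (x i < x j + s → d i < d j + s ∨ (d i = d j + s ∧ P i < P j)) ∧
    (x i = x j + s → d i = d j + s ∧ P i = P j) ∧
    (x j + s < x i → d j + s < d i ∨ (d i = d j + s ∧ P j < P i)) := by
  induction hN : posRank x i + posRank x j using Nat.strong_induction_on generalizing i j s with
  | _ N ih =>
    rcases lt_trichotomy (pos x j) (pos x i) with hji | hji | hij
    · obtain ⟨k, t, ht, hki, hle, hmax, hd, hor⟩ := H i j hji
      have hrk := posRank_lt hki
      have hC : (x k + t < x j + s → d i < d j + s ∨ (d i = d j + s ∧ P k < P j)) ∧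
          (x k + t = x j + s → d i = d j + s ∧ P k = P j) ∧
          (x j + s < x k + t → d j + s < d i ∨ (d i = d j + s ∧ P j < P k)) := by
        rcases le_total t s with hts | hst
        · obtain ⟨h1, h2, h3⟩ := ih _ (by omega) k j (s - t) (by omega) rfl
          rw [Nat.cast_sub hts] at h1 h2 h3
          refine ⟨fun h => (h1 (by linarith)).imp (by omega) fun h => ⟨by omega, h.2⟩,
            fun h => (h2 (by linarith)).imp (by omega) id,
            fun h => (h3 (by linarith)).imp (by omega) fun h => ⟨by omega, h.2⟩⟩
        · obtain ⟨h1, h2, h3⟩ := ih _ (by omega) j k (t - s) (by omega) rfl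
          rw [Nat.cast_sub hst] at h1 h2 h3
          refine ⟨fun h => (h3 (by linarith)).imp (by omega) fun h => ⟨by omega, h.2⟩,
            fun h => (h2 (by linarith)).imp (by omega) Eq.symm,
            fun h => (h1 (by linarith)).imp (by omega) fun h => ⟨by omega, h.2⟩⟩
      obtain ⟨h1, h2, h3⟩ := hC
      rcases hor with ⟨hx, hP⟩ | ⟨hx, hP, hgap⟩
      · rw [hx, hP]
        exact ⟨h1, h2, h3⟩
      · refine ⟨fun h => ?_, fun h => ?_, fun h => ?_⟩
        · refine (h1 (by linarith)).imp id fun ⟨h4, h5⟩ => ⟨h4, ?_⟩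
          by_contra h6
          exact h5.not_ge (hgap j hji (by omega) (not_lt.mp h6))
        · exact absurd (hmax j s hs hji h.ge) (by linarith)
        · rcases (hmax j s hs hji h.le).lt_or_eq with h4 | h4
          · exact (h3 h4).imp id fun ⟨h5, h6⟩ => ⟨h5, h6.trans hP⟩
          · exact Or.inr ⟨(h2 h4.symm).1, (h2 h4.symm).2 ▸ hP⟩
    · obtain rfl := pos_injective x hji
      have : (0 : ℝ) ≤ s := Nat.cast_nonneg s
      refine ⟨fun h => Or.inl ?_, fun h => ⟨?_, rfl⟩, fun h => by linarith⟩
      · have : (0 : ℝ) < s := by linarith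
        have : 0 < s := by exact_mod_cast this
        omega
      · have : (s : ℝ) = 0 := by linarith
        have : s = 0 := by exact_mod_cast this
        omega
    · obtain ⟨k, t, ht, hkj, hle, hmax, hd, hor⟩ := H j i hij
      have hrk := posRank_lt hkj
      have hxij := le_of_pos_le hij.le
      have hik := hmax i 0 (Nat.zero_le _) hij (by simpa using hxij)
      simp only [Nat.cast_zero, add_zero] at hik
      obtain ⟨h1, h2, -⟩ := ih _ (by omega) i k t ht rfl
      have hs0 : (0 : ℝ) ≤ s := Nat.cast_nonneg s
      have hPk : P k ≤ P j := by
        rcases hor with h | h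
        · exact h.2.ge
        · exact h.2.1.le
      have hdle : d i < d j ∨ (d i = d j ∧ P i ≤ P k) := by
        rcases hik.lt_or_eq with h | h
        · exact (h1 h).imp (by omega) fun h => ⟨by omega, h.2.le⟩
        · exact Or.inr ⟨by have := (h2 h).1; omega, (h2 h).2.le⟩
      rcases Nat.eq_zero_or_pos s with rfl | hspos
      · simp only [Nat.cast_zero, add_zero]
        refine ⟨fun h => ?_, fun h => ?_, fun h => by linarith⟩
        · rcases hik.lt_or_eq with h' | h'
          · exact (h1 h').imp (by omega) fun h => ⟨by omega, h.2.trans_le hPk⟩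
          · have h4 := h2 h'
            rcases hor with h5 | h5
            · linarith [h5.1]
            · exact Or.inr ⟨by omega, h4.2 ▸ h5.2.1⟩
        · have h4 := h2 (by linarith)
          rcases hor with h5 | h5
          · exact ⟨by omega, h4.2.trans h5.2.symm⟩
          · linarith [h5.1]
      · have hspos' : (0 : ℝ) < s := by exact_mod_cast hspos
        refine ⟨fun _ => Or.inl ?_, fun h => by linarith, fun h => by linarith⟩
        rcases hdle with h | h <;> omega

theorem pointTree_compat : Compat mv (pointTree mv m hm x) (pointMarks mv x) x := by
  have hμ := pointTree_isMarking (mv := mv) (hm := hm) (x := x)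
  have H := compare_of_attached (mv := mv) (x := x) (d := (pointTree mv m hm x).drift)
    (P := key (pointTree mv m hm x) (pointMarks mv x)) (by
      intro i l hl
      obtain ⟨j, s, hp⟩ := exists_isPar mv hl
      obtain ⟨k, t, ht, hk, he, hch, hd⟩ := hp.exists_chain (hm := hm)
      have hc := pointTree_isChild_iff (hm := hm).mpr hp
      have hkey := hch.key_eq hμ
      refine ⟨k, t, ht, hk.trans_lt hp.lt, he ▸ hp.le, fun l u h1 h2 h3 => he ▸ hp.max l u h1 h2 h3,
        hd, ?_⟩
      by_cases hi : i ∈ pointMarks mv x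
      · refine Or.inl ⟨he ▸ (mem_pointMarks_iff hp).mp hi, ?_⟩
        exact Chain.key_eq hμ (hch.tail ⟨hi, s, hc⟩)
      · refine Or.inr ⟨lt_of_le_of_ne (he ▸ hp.le) fun e => hi ((mem_pointMarks_iff hp).mpr ?_), ?_,
          fun j' hj' hd' hle => ?_⟩
        · rw [← he, e]
        · rw [← hkey]; exact key_lt_of_isChild hμ hi hc
        · rw [← hkey]
          rcases hle.lt_or_eq with h | h
          · exact key_le_of_key_lt hμ hi hc hd' h
          · have h5 := key_eq_iff.mp h
            rw [top_eq_self hμ hi] at h5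
            exact absurd (pos_le_of_pointTree_chain (h5 ▸ (top_spec hμ j').1)) hj'.not_ge)
  intro i j s hs
  obtain ⟨h1, h2, h3⟩ := H i j s hs
  rcases lt_trichotomy (x i) (x j + s) with h | h | h
  · have h' := h1 h
    refine ⟨iff_of_true h h', iff_of_false h.ne ?_⟩
    rintro ⟨ha, hb⟩
    rcases h' with h' | ⟨-, h'⟩
    · omega
    · exact h'.ne hb
  · have h' := h2 h
    refine ⟨iff_of_false h.not_lt ?_, iff_of_true h h'⟩
    rintro (h4 | ⟨-, h4⟩)
    · omega
    · exact h4.ne h'.2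
  · have h' := h3 h
    refine ⟨iff_of_false h.not_gt ?_, iff_of_false h.ne' ?_⟩
    · rintro (h4 | ⟨h4, h5⟩) <;> rcases h' with h' | ⟨h6, h7⟩
      · omega
      · omega
      · omega
      · exact lt_asymm h5 h7
    · rintro ⟨h4, h5⟩
      rcases h' with h' | ⟨h6, h7⟩
      · omega
      · exact h7.ne' h5

end Construction

end Braid

theorem multi_catalan_faces (n : ℕ) (hn : 0 < n) (mv : Fin n → ℕ) (m : ℕ)
    (hm : m = Finset.univ.sup mv) :
    Braid.IsStronglyTransitive m n (Braid.multiCat n mv) ∧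
    Braid.OTset m n (Braid.multiCat n mv) = Braid.reachTrees m n mv ∧
    Set.BijOn
      (fun p : Braid.LTree m n × Set (Fin n) =>
        Braid.PhiBar m n (Braid.multiCat n mv) p.1 p.2)
      (Braid.reachTrees m n mv)
      {F | Braid.IsFace n (Braid.multiCat n mv) F} := by
  open Braid in
  have hle : ∀ i, mv i ≤ m := fun i => hm ▸ Finset.le_sup (Finset.mem_univ i)
  refine ⟨multiCat_stronglyTransitive m hm, OTset_eq_reachTrees, ?_, ?_, ?_⟩
  · rintro ⟨T, μ⟩ hp
    obtain ⟨hμ, hr⟩ := mem_reachTrees_iff.mp hp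
    obtain ⟨y, hy⟩ := exists_compat mv T μ
    exact isFace_iff_signClass.mpr ⟨y, (PhiBar_eq hμ hr hle).trans hy.eq_signClass⟩
  · rintro ⟨T, μ⟩ hp ⟨T', μ'⟩ hp' he
    obtain ⟨hμ, hr⟩ := mem_reachTrees_iff.mp hp
    obtain ⟨hμ', hr'⟩ := mem_reachTrees_iff.mp hp'
    obtain ⟨y, hy⟩ := exists_compat mv T μ
    have hy' : y ∈ PhiBar m n (multiCat n mv) T' μ' := 
      (Set.ext_iff.mp he y).mp (hy.mem_PhiBar hμ hr)
    obtain ⟨rfl, rfl⟩ := hy.tree_unique hμ hr hμ' hr' (compat_of_mem_PhiBar hμ' hle hy')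
    rfl
  · intro F hF
    obtain ⟨y, rfl⟩ := isFace_iff_signClass.mp hF
    refine ⟨(pointTree mv m hle y, pointMarks mv y),
      mem_reachTrees_iff.mpr ⟨pointTree_isMarking, pointTree_reachCond⟩, ?_⟩
    exact (PhiBar_eq (pointTree_isMarking (hm := hle)) pointTree_reachCond hle).trans
      pointTree_compat.eq_signClass
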